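/- Up to symmetry, there are exactly 15139 reflexive canonical subpolytopes of 4Δ₃. That is, the set of 3-dimensional reflexive lattice polytopes P ⊆ 4Δ₃ with P = conv(P ∩ ℤ³) and (1,1,1) in the interior of P decomposes into exactly 15139 orbits under the group G of affine symmetries of 4Δ₃. -/

import Mathlib

open Set MeasureTheory

noncomputable section

/-- Points of `ℝ³` with integer coordinates. -/
def latticePts : Set (Fin 3 → ℝ) := {x | ∀ i, ∃ n : ℤ, x i = (n : ℝ)}

/-- The point `(1,1,1)`. -/
def pOne : Fin 3 → ℝ := ![1, 1, 1]

/-- The tetrahedron `4Δ₃ = conv{(0,0,0),(4,0,0),(0,4,0),(0,0,4)}`. -/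
def Delta4 : Set (Fin 3 → ℝ) :=
  convexHull ℝ {![0, 0, 0], ![4, 0, 0], ![0, 4, 0], ![0, 0, 4]}

/-- A subpolytope of `4Δ₃`: a lattice polytope `P ⊆ 4Δ₃` with `P = conv(P ∩ ℤ³)`. -/
def IsSubpolytope (P : Set (Fin 3 → ℝ)) : Prop :=
  P ⊆ Delta4 ∧ P = convexHull ℝ (P ∩ latticePts)

/-- A canonical subpolytope of `4Δ₃`: a subpolytope with `(1,1,1)` in its interior
(this forces it to be `3`-dimensional). -/
def IsCanonicalSub (P : Set (Fin 3 → ℝ)) : Prop :=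
  IsSubpolytope P ∧ pOne ∈ interior P

/-- The standard inner product on `ℝⁿ`. -/
def dotp {n : ℕ} (a x : Fin n → ℝ) : ℝ := ∑ i, a i * x i

/-- Equivalence of subsets of `ℝ³` under the group of affine symmetries of `4Δ₃`. -/
def SymEquiv (P Q : Set (Fin 3 → ℝ)) : Prop :=
  ∃ g : (Fin 3 → ℝ) ≃ᵃ[ℝ] (Fin 3 → ℝ), g '' Delta4 = Delta4 ∧ g '' P = Q

/-- `F` is a facet of `P`: an exposed face of dimension `2`. -/
def IsFacetOf (F P : Set (Fin 3 → ℝ)) : Prop :=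
  ∃ (a : Fin 3 → ℝ) (b : ℝ),
    (∀ x ∈ P, b ≤ dotp a x) ∧ F = P ∩ {x | dotp a x = b} ∧
    Module.finrank ℝ (affineSpan ℝ F).direction = 2

/-- `P` (canonical, with interior lattice point `p`) is reflexive: every facet lies on an
integral hyperplane at lattice distance one from `p`. -/
def IsReflexive (P : Set (Fin 3 → ℝ)) (p : Fin 3 → ℝ) : Prop :=
  ∀ F, IsFacetOf F P →
    ∃ (a : Fin 3 → ℤ) (b : ℤ),
      (∀ x ∈ F, dotp (fun i => (a i : ℝ)) x = (b : ℝ)) ∧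
      (∀ x ∈ P, (b : ℝ) ≤ dotp (fun i => (a i : ℝ)) x) ∧
      dotp (fun i => (a i : ℝ)) p = (b : ℝ) + 1

namespace Quartic

/-- Barycentric coordinate `c` of the `v`-th boundary lattice point of `4Δ₃`. -/
def bary (v c : ℕ) : ℕ := 0112012102111012102120111102120121011120121021100013002200310103020203011003200230010130022003101030202030101300220031000004004004004000 / 10 ^ (4 * v + c) % 10

def pt (v : ℕ) : ℤ × ℤ × ℤ := (bary v 0, bary v 1, bary v 2)
def ctr : ℤ × ℤ × ℤ := (1, 1, 1)

def sub (u v : ℤ × ℤ × ℤ) : ℤ × ℤ × ℤ := (u.1 - v.1, u.2.1 - v.2.1, u.2.2 - v.2.2)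
def dot (u v : ℤ × ℤ × ℤ) : ℤ := u.1 * v.1 + u.2.1 * v.2.1 + u.2.2 * v.2.2
def cross (u v : ℤ × ℤ × ℤ) : ℤ × ℤ × ℤ :=
  (u.2.1 * v.2.2 - u.2.2 * v.2.1, u.2.2 * v.1 - u.1 * v.2.2, u.1 * v.2.1 - u.2.1 * v.1)
def nrm (i j k : ℕ) : ℤ × ℤ × ℤ := cross (sub (pt j) (pt i)) (sub (pt k) (pt i))
def dst (i j k : ℕ) : ℤ := dot (nrm i j k) (sub ctr (pt i))

def mask (p : ℕ → Bool) : ℕ :=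
  (List.range 34).foldr (fun l acc => bif p l then 2 * acc + 1 else 2 * acc) 0

def rays (i j : ℕ) : ℤ × ℤ × ℤ := cross (sub (pt i) ctr) (sub (pt j) ctr)

def famInt : List (ℕ × ℕ) :=
  ((List.range 34).flatMap fun i => (List.range 34).flatMap fun j =>
    bif decide (rays i j = (0, 0, 0)) then [] else
      [mask fun l => decide (dot (rays i j) (sub (pt l) ctr) < 0)]).foldr
    (fun m acc => bif acc.any fun q => Nat.beq q.2 m then acc else (0, m) :: acc) []

def badTriple (i j k : ℕ) : Bool :=
  !decide (dst i j k = 0) && !(decide ((nrm i j k).1 % dst i j k = 0) &&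
    decide ((nrm i j k).2.1 % dst i j k = 0) && decide ((nrm i j k).2.2 % dst i j k = 0))

def famRef : List (ℕ × ℕ) :=
  (List.range 34).flatMap fun k => (List.range k).flatMap fun j => (List.range j).flatMap fun i =>
    bif badTriple i j k then
      [(2 ^ i + 2 ^ j + 2 ^ k,
        mask fun l => decide (dst i j k * dot (nrm i j k) (sub (pt l) (pt i)) < 0))]
    else []

def face (f : ℕ) : List ℕ := (List.range 34).filter fun v => Nat.beq (bary v f) 0

def co (f c v : ℕ) : ℤ := bary v ((f + c) % 4)
def area (f a b c : ℕ) : ℤ :=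
  (co f 1 b - co f 1 a) * (co f 2 c - co f 2 a) - (co f 2 b - co f 2 a) * (co f 1 c - co f 1 a)

def onSeg (f i j y : ℕ) : Bool :=
  decide (area f i j y = 0) && decide ((co f 1 i - co f 1 y) * (co f 1 j - co f 1 y) +
    (co f 2 i - co f 2 y) * (co f 2 j - co f 2 y) < 0)

def inTri (f i j k y : ℕ) : Bool :=
  decide (0 < area f i j k * area f i j y) && decide (0 < area f i j k * area f j k y) &&
    decide (0 < area f i j k * area f k i y)

def famSeg : List (ℕ × ℕ) :=
  (List.range 4).flatMap fun f => (face f).flatMap fun j => (face f).flatMap fun i =>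
    bif Nat.blt i j then (face f).flatMap fun y =>
      bif onSeg f i j y then [(2 ^ i + 2 ^ j, 2 ^ y)] else []
    else []

def famTri : List (ℕ × ℕ) :=
  (List.range 4).flatMap fun f => (face f).flatMap fun k => (face f).flatMap fun j =>
    bif Nat.blt j k then (face f).flatMap fun i =>
      bif Nat.blt i j then (face f).flatMap fun y =>
        bif inTri f i j k y then [(2 ^ i + 2 ^ j + 2 ^ k, 2 ^ y)] else []
      else []
    else []

def fam : List (ℕ × ℕ) := famInt ++ (famRef ++ (famSeg ++ famTri))

def column (h : ℕ × ℕ → ℕ) (W : List (ℕ × ℕ)) (v : ℕ) : ℕ :=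
  W.foldr (fun q acc => bif (h q).testBit v then 2 * acc else 2 * acc + 1) 0

/-- The columns of the incidence structure of `fam`: the `v`-th entry consists of the bit masks of
the patterns `(I, O)` with `v ∉ O` and of those with `v ∉ I`. -/
def rows : List (ℕ × ℕ) := [
  (8079251517827751825178719172167487990111025667428871008032586356881163784716972723299300352880728365922179490230474504873529889787622730273772038096612070780157719341825249022937549437597413026699014409596016892069198054660654939040459523584619042617645411463009076260721893972885043473865359352599193123001730445431903992605287366861463671309095640169113972965016583154051059285520992119539823982993450147059864682387868448953392321518995181484900502660286524612127076302780807646684233156046573561206144307520029786843055551302917385423725676016522031108021860683711362912013360504667122668592368793695887859565823,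
   8079251517827751825178719172167487990111025667428870984940033168007907264872765418635831798518585743379285377789843312373305089090282458092046262364588850073805036988652669894766535020711431591271708462902187377648768904676233806708651207506462550956673124848517851384194256743962939275645608804074650447375303160843996851012121232668306336395486610983919883529815453919199837223467302290988727345495907541564832143019642026158357671600412765552233003951021708493463487012022656884627886606201562074235240935272803149573387952867471038672538649090102508623037377398744623919423903238272999378021866851012496924344319),
  (8079251517827751825178719172167487990111025667428871008032586356881163784716972723299300352880728365922179490230474504873529889787622730273772038096612070780157719341825249022937549437597413026699014409596016892069198054660654939040459523584619042617645411463009076260721416037941064542870325866664936165961869669591933978021124425113554936120196126194253201085657782983929015380352026853890128110471129840660448600185846744049961997623661066521189220993145699175258471079198295180340578424523949007792173551353104877319539584465833579333756048707600768534301741014016759676299076412260564280650920673577434653687788,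
   3655597169183173355274964251106954798532659650847238470834311235186763254315678335046294976563933377798245452685727635324646815568829513596523323508645590587981182958485058480803295255734105597257406170633366942887610968901115140021146777326860819836856418184243501740201762837524996171897375309204764317860002564457204753170613788389976331890527891327839127972708182064507919919357787489158410801582229453707415924388245822104045450371975279701354271230416756917423357052030281457638223757105694761499260158439944539899859291778298649506542757814542071523172483925425615381965027692579335204358227833486879383093247),
  (8079251517827751825178719172167487990111025667428871008032586356881163784716972723299300352880728365922179490230474504873529889787622730273772038096612070780157719341825249022937549437597413026699014409596016892069198054660654939040459523584619042617645411463009076260721630282759860370138726800922341332182484669657555119573887450749655060049443887341325437017883497040353830085990170366678058681333456702412008463153385567479702393847407542124112189161767035354584312495140601565463952344013288870540544966553033711581604259603483004202483066111178532095937280684788378732630795295096314476728165654374091914214919,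
   6032933524500685390214542377322804559567495939449093445345784912661538604815203243199743976543690552548334223566951350206079164551666112911387403837722484233325423035070019268965839473041036887185400499803032827117189087071020684170177230590298447488199877315923960570288698370738077015503335474346913324554772873619330539963853065656627455904482036015239349039669330897478888298208004314233417827662292673204619559206189732872611576241210157395747805960560817393350753831034242947304595374059443612225658404365632586970854557836005911498330011141389997116902376231781763004462585853053295292441975084629739570200575),
  (8079251517827751825178719172167487990111025667428871008032586356881163784716972723299300352880728365922179490230474504873529889787622730273772038096612070780157719341825249022937549437597413026699014409596016892069198054660654939040459523584619042617645411463009076260721679313031668274992631618374750782346389539639602809211054911751134989995500269772213328888102770412675879667441927190324277519415067605002855212832562795990129488444640720705604398797360922974305155218270218903803154379786271175784760202967891689159974243922488969001626740834829983529846214046526513819208256469639301358064008831233664047063922,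
   8079189520486203152591311410235793774971587934446517016067050204844990303275475197052829627635953112859058628013281791750269700047792307269030314016761880422544960257068770556957310239646584580163594531458092706985716166529352629321538466550765827603020668645757999136206613172565082953620674883961126393685669498531227570633843160950925144359035332345766803385667576033360853312564421453013966796941484377077632243768462344450710497196888913831242025048796303801176175577517814457997886683907920057127449445278263478648389023104938238232129758261837451802076197275232662519490776483917525196945920471011708865871871),
  (8079251517827751825178719172167487990111025667428871008032586356881163784716972723299300352880728365922179490230474504873529889787622730273772038096612070780157719341825249022937549437597413026699014409596016892069198054660654939040459523584619042617640452271886895640897951025248995048904357753234857315534732273370284296946020551105276453359705454257571865782331401121251773984316308344698580999814328827601557426080902638843074057414768443922808843749811004985400764719263682130348441655756652450175385381891535566185783212239686640530136854042183588131148593561671481259576238180408317183480022454313988310095084,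
   8079251517827751825178719172167487990111025667428871008032586356881163784716972723299300352880728365922179476456518318733203818958773610166249703122345654943651688672245852195143100852302220450273553812703214588814120816684988630850234786705538549671905183005845511864401073800889896434698272817335612981172764796678496469739697478657108353956963197353716003762679197599107583323367431784738024615784255340560801884299442261201098237238033770974218990821840319901144969800167692359411948369369734754945052789285675035407495411662875770578396413214564449554403444322887877863374760926800763434582053246396019469451263),
  (8079251517827751825178719172167487990111025667428871008032586356881163784716972723299300352880728365922179490230474504873529889787622730273772038096612070780157719341825249022937549437597413026699014409596016892069198054660654939040459523584619042617618825592650933555260905842926981445581364919343994151601280490966021864259697560752936003485800818766189814480788484663845019704082367501083442348469271568782364760316566031469454819466003359633759640273884369814072059715524765854333474175139224971625061708495137130007819115543178005537436143677630667088978175610804235182575123701025646296994020094883361439929580,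
   8079251517827751825178719172167487990111025667428871008032586356881163784716972723299300352880728365922179461768915847256643568352818455481954408157872617096096083395078412859466277456945186160382252265719290854537263487901125334789136944544677933087779730789376036429137815904226294553666188512348564481155946598148519871553652631041309304480302904081387058311672602515873477110764310303135430249595500944385249321982342905441455178678547636330766051615469368917932440956016490773697331141372029708003259958862713530143448322694557555933512951740201555382220476813566933278386788680925689607401613902981930363650047),
  (8079251517827751825178719172167487990111025667428871008032586356881163784716972723299300352880728365922179490230474504873529889787622730273772038096612070780157719341825249022937549437597413026699014409596016892069198054660654939040459523584619042617644032908497599371665425457996595354816916504191460299211563886589008784522900448422562272294878940638537873256556945502645876333856847711821445171923921286723918064215739696974140094706434716630802679890944371167599938003501399009241256717876636532359311621058119646115791842479415242759562909268214728761721287919785994021904333963551130409120642476341371064579308,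
   8079251517827751825178719172167487990111025667428871008032586356881163784716972723299300352880728365922179488402914495554040035798748835333592747979850967685575712951198513768639787600337024179878125717286474526503656509446587181736466955438299490573039379712662679586456153871014156449660969985686307600073304577828197813532194379553190291694942357340221265731182505279910886433951610970442338708302726575212425302302481988326497142036315978172456772437786682122593199660856155730424469286803437015321978755255409888079681478015692321498187925368029795095427943204813746450561305797872894723077224731370798159233023),
  (8079251517827751825178719172167487990111025667428871008032586356881163784716972723299300352880728365922179490230474504873529889787622730273772038096612070780157719341825249022937549437597413026699014409596016892069198054660654939040459522188730836998168411920275275451067234293156917655968031050642911203410894717205529554725188701091854743296903363474921544420969169611150184265060907899845748480759410369332284139903052300840396181910959458092141336989778466232190092098035891251043382346078938465057288435722591688832750419476824502800943861324524323901724743929915908442803597771361719771257808510661891448554695,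
   8079251517827751825178719172167487990111025667428871005394020552463391945368738473234635585544003359475750115218081587055633470358371353057803404817873169592572406624607185973470315576315992152719994996093876576471205110689875294183004890642058783387683532625001953668961962217011543421546531757968261052591024676684376715706648471829442326686441365093581041918401312096123498444287744180378430784975407432192000030813607256705981087197258526897404952876631970885547392626684600558456941493525696679685595633984029836044876854927582734669837613101150842236817674875794425429393605084301194434102075454758555781955583),
  (8079251517827751825178719172167487990111025667428871008032586356881163784716972723299300352880728365922179490230474504873529889787622730273772038096612070780157719341825249022937549437597413026699014409596016892069198054660654939040459516101361802726934287890401766045673403234465747262041348171619312553946746524291303802672152377897645919204353118879102624388872716968746778434599835574621572529404649622871675088825891007414816911730705398820546645181668876817822780005969266605275196255005777694888303898594580900268818652981559397897481269291541154455182982374419610452786535990439786061099667240417875833310343,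
   8079251517827751825178719172167487990111025667428871002580434890769812303538365525387356064636494233760549842642582139332397681974068920582137267259361034689568959076206659246536767135487202713272541164211701999660126815563363183297052738681764612439008967679048788583157968171373681158706414770027102929240817867128330870698295484815702142070896103942249741992300044574516363751960929463303010954156612532801947671539143804991417136065672369024201324281118499243997908699241314271556856905389146053976397745806957035428849392533348080737453066081001560751703722888502793528893844308090589587031673505111357733732351),
  (8079251517827751825178719172167487990111025667428871008032586356881163784716972723299300352880728365922179490230474504873529889787622730273772038096612070780157719341825249022937549437597413026699014409596016892069198054660654939040459523196590443605319683385269804668210014251410510157631617107177322056971226128819035112373994775935335483089711230810836058206169472656091437090355674104339964260008444009413871791252557312171094601840260899570578928977905671233759289439270365433535728443946163474277232131306584052855694447048867413562602688513412771929260208258981870533690449348811458687119223287005480498941575,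
   8079251517827751825178719172167487990111025667428871007682495411262796223921444776210588274649639475080159796670447576175102097183829398391966891138418428926196679270535107831128942747454161659829145235639275055507720169541732349638469601645335749721078363806589257063638889238078418240943189310474145092982745809321847043947057433833246783729359588554810152750172916101299543588149585130522968849139112611228795771835143365678785872142802399194355411362033608008128684222158577364071141334609297720091623035527858491878938785928878245456158863290633304009888517621126299887246688563598206875761782722623902788354047),
  (8079251517827751825178719172167487990111025667428871008032586356881163784716972723299300352880728365922179490230474504873529889787622730273772038096612070780157719341825249022937549437597413026699014409596016892069198054660262031440292101902387484565899000580343710852646770091946464544980699350018646501653845426312006730369877374173166947242931447110283391869617957554659295830807213275701705101007607164007776331670778390393699553707201504187678523025027012044146096330409729768567953436907070386293242863809795768637861464672142604211891208268723203863595950982884135900731213523774249077354610011218950383238701,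
   7573802726633820278600038732176148219707929907573887683600715685852945433621275849871414174734729383754139997389409983671607425783184148238852117720070158843988789815154393482811891938120842399440281992526512903611549091817044692436333769307498904031017879597083805233065468990835143227329827574683646038422449107001572787432479504055639355194696604224748428255943102129973707552732756922791593788083059057345394831519307702977307148612550250765204052191724799609930861646237565516459474520256545053305774283542704745989960794778691116149821896603445721980322847660464812983841026434355044461534690265274475593334783),
  (8079251517827751825178719172167487990111025667428871008032586356881163784716972723299300352880728365922179490230474504873529889787622730273772038096612070780157719341825249022937549437597413026699014409596016892069198054658548589383141437771416736777170348769306221018474297759541431944177647844665258806569744326043799085643178722435515577414476528567307878217736496573316640351987569878670529289622321531439114953746502398301772354778090988721245606974282129273903209571104319388584193132686404491895443457180005453354349462344157891207070761137896352427947948292326270919206604982854066335490392008115827317440013,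
   7034826791585118763070399724849924601965697436397744742647864767970621066840584049895944960604621480585904328024181364020395143343923089498036778593164048870611649372269641003594866899724524034900087545293784878089309338841879627418411312133786341332997526390418223069041208764089920513106309674822360873783681937074707635579117068561873270650768092075188287763015616470992385757198094676411935627957425687586808463462174616342841493715246686916612511783037264247952428149734136943158484334646326173147985605235095701192105427264056103004598889171541109241405658728221705632531970081263280151268535904459015143292927),
  (8079251517827751825178719172167487990111025667428871008032586356881163784716972723299300352880728365922179490230474504873529889787622730273772038096612070780157719341825249022937549437597413026699014409596016892069198054660545718699589460724544475078061588462826019579685803647708968843504478308475449977007762310254991547990430008565864237175691459956787374733839170502798830802765240881501623609622426517318549167681676885371842027415109060070028386199147244643114840654473707171651152370952662390127447900901418641671139571116251940193473200738172413890677692383307098348353966632624379602623129142820266004741639,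
   8012187416195542990400855688230628604351334097724229244271636197052969284877895992037305166037467010834624509523519895377484000533705485391589762705919972322604623950781487259466304120412992896448157581410454724118461133859933230141422261363955654409460622715836655223103648163571233883684593194649044596236462476524934339835357813574300117837374036727872372716772704225304305063335376000473029419658346150447933786844368722823242292866725611220664540099994086287489630951702637929958845948544938728517402765094085294017704940991413207527872038492889212917160549342666614510216863420762631367179132980580336378314751),
  (8079251517827751825178719172167487990111025667428871008032586356881163784716972723299300352880728365922179490230474504873529889787622730273772038096612070780157719341825249022937549437597413026699014409596016892069198054660654939040458848631134996683547438977801230566733494606555957128660561146334893788344286540474682425022859218465509652880826184469314066680119047922068923499803307539469771449944276541669866201734747700729249594652535744964268522465796910323516320028913032926167475616339006150911377578180737385148850152584985803378196588761805094552054766890103016428165385660959471185552622831489006554760690,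
   8079251517827751825178719172167487990111025667428871007414698067387635667485059882603254046601673687315222792621702284436738852720976482275917463717678985765012258178680710314723679996551816098170154523128949592868716610776743303110675427236784856071471618930010995677822156432824219013365902579746835348203163352511275969788076836689480423494446879438703266185612846320356671282312706887377434305484044174579099664141243444158522889639568397439112436347910453441279027085422682740516238263503495119340248201594794564475998563597692007641300580217216984257904401502382177743109529006100343943438034852808006079348735),
  (8079251517827751825178719172167487990111025667428871008032586356881163784716972723299300352880728365922179490230474504873529889787622730273772038096612070780157719341825249022937549437597413026699014409596016892069198054660654939040448079161810445405562785987110265390465362135817948206598897218964061740982169880629352392550302605980848631953985156811630634813073188888880990503055403066457256221736011839422919881748270437332443931063168284780845016429300756408224107620295181490987966193668382999768639083008943241927401014445756637642413749370178046582193861309721786535493972501097428105393918052241968253075954,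
   8079251517827751825178719172167487990111025667428871008032421070238757101055603999612132806782729315196548374922721810608751838755388362157687577719247811377271209462498659098384481555984214886246741651378119657456446294133920284299020544997560948050109012327685525501998338052780978132040254854903925481146930238012810449972081898506419209408444980453360477675705599395978552689151430390114099666060073127924003173771715728028512718604719069006033090853804873617200008447501788909572133581524192635783202458518476363623714131186339247752472620804674346329507142833986451468176062678368836003616681531670159773663231),
  (8079251517827751825178719172167487990111025667428871008032586356881163784716972723299300352880728365922179490230474504873529889787622730273772038096612070780157719341825249022937549437597413026699014409596016892069198054660654939040459344918198579979923351264943389009349257923130213707119660811622726071507836864098189547343860588542585008205227091427714419405986887373956650960896018558336548498405677017296669646857215445165232240666797950739277114894605544861791415351122599587333921040777264874736647177791857897598865261874741472805701233995101323736422473215536590992210164283206207359321744017042570170311538,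
   8079251517827751825178719172167487990111025667428871008032571271023555342372668694369605620884656869175203619640885471909104041509833052626301274108255112740553048025055065113689941384474167539726465099662968239020890881510940509944045142441756006866669368755173173015126834091508422110235271002633122039672017768969807785104928830264544381879002468397542875750672800599796505150236136421077081384332613362842607217059290536586032066090457932326359438215489279629445634103890008929755235061077174723724217361235951476765896796722532207535582561968551863103643017981252356024524458251405631004395312408354091144577023),
  (8079251517827751825178719172167487990111025667428871008032586356881163784716972723299300352880728365922179490230474504873529889787622730273772038096612070780157719341825249022937549437597413026699014409596016892069198054470672422837854772255568784394461007036731823131813648122159505362608715893654456905037933131111762517941245179022412205452611712849253902958678385336186638349466701695458280854856040687314365427811088138602842359706948226883129060062139130442740063606182296028525600131564265154078143928287585827538596395936871778569589377837943767881943231730187966670771975428947885278341860045393097937482604,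
   7960887636777491414665588363979081988647991224858327717578838905350546152895771949121191303859923185035768257730502845438700953981610499529450567002473421467419880854173861568384855931647027490414334154375835047178223757364192361822835892072034545081306594353962357978740385494203461291391975157299513161229129545024777963990591103239290351225273443743910808899967390039228486707053681203332458045024156631410504139163890415128362617075317027806269240428255544248852609097924060885190086965501404653773237943361774487866313995493904156559412266712119784903054419426261931605107057170056728140948828448122561332510719),
  (8079251517827751825178719172167487990111025667428871008032586356881163784716972723299300352880728365922179490230474504873529889787622730273772038096612070780157719341825249022937549437597413026699014409596016892069198051439336295523670367917050778744936005222827129703349100775314851012925745430398279743675487984593799049786563935574111070854174702997696572787747224329938751111273248648945666724275520395923788403639388411020085307795445147560873068290952769119796032607656465972303620359525804124261018118295666214055428374027410841104803569112568284527222923897328727563591769857594205817507755072742314486084472,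
   8079219855197445207998802441291222923384326768444156715766588084589703091585142311600258094407251368596189074275961258445480528661834394605519715457986446006785343237561212545264067075992505105843161676123221624415738242421217405849204033985644998512760608303041650223577364138353811536542090243635270387115397263866919680561836180808763380666394981915948162865256525689360869704326203128370099781727514016008737679594607330185290091759799391755121688111503572946792880296748482929672568161026544313065360311994533834819275966950005221697536279142968886608400177000223900619885032046993324672388509091255188453326847),
  (8079251517827751825178719172167487990111025667428871008032586356881163784716972723299300352880728365922179490230474504873529889787622730273772038096612070780157719341825249022937549437597413026699014409596016892069198054610364812501762476837154306385265573006705670705686042662032432515470879200224812633019681036559419967095108186683990961952455774630937306560669328650636836122110547095602605336514033242862240416662198414134212190620856798086563685740235593262781021488396896711274479676560910257710705024166892547438554788875700032650525359578866073944860013784381824818492770435532164907092434105115677133316986,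
   8079248627951562440724342297234527689242609320838045193542186089755631008928552380785991294782305139314919846358089497107262615937493569274248216004371195162206953016005993329424043173993360531484143522466868055321806059948136385949140692623476953547716373173886931905291145839297178150258810686336329170049488875721704408142402822639159508719991484509970928743888368501841386038956862931860580383109470846422761108541991258434835602611956059779637706642130102465499054712733472963672226754744830151631773820495502290361811942557748017717529319945754564251324007477770526081091195238232985105671847854423755559272447),
  (8079251517827751825178719172167487990111025667428871008032586356881163784716972723299300352880728365922179490230474504873529889787622730273772038096612070780157719341825249022937549437597413026699014409596016892069194941989901969389358520146560621200953345048559256602718118882408116880870865685191005113714409549476133992741444283289669497608635470178771492437228294610460568805081496313513256282741659989879913758518828141541347326862763656154575261755532220335158401120117519917124227621314744936848201295818420257718509179985665823352272307597770783276133542594152201614460020549984276992219775104143686150598167,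
   6185676943292727314407704596737731502817441066939591519898833400816917161222246452519732316080956225514433364907306449907887930369755837374613916170312915871137247752787372148570304634648901348606022379292051879324352962987355914446396682033151538726944908359393783949778178509948977152575996613908419536940011766008906723530256833086735704719539964362101905066475235095611240443041319140396972779494483485664669995259575401970484944015708286210274934230336065163783714823443656355048637959736733406102983632930492082936584600423576501002031634079297226004874345810926242746411218944852473393846277958706813040852991),
  (8079251517827751825178719172167487990111025667428871008032586356881163784716972723299300352880728365922179490230474504873529889787622730273772038096612070780157719341825249022937549437597413026699014409596016892069145316634333189433889736131435328049547360212715186139931197028929743836067567782331527773633995423975092380641233837684622894077820513818213050648065196635561796547895786681250810229064657341523317647958040159482362176062467151503762802646430727191185520668492839861599182543055297185655294235207075825993489392443634026848027539807848778476027118570620701185293069458687675270190259780520978014481171,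
   8079251516945815231603787193379191544566160827815828192615530777626711554233743120887435925997004161037751424036472291668119177716879351701333603440255406630335365595073364556666762333501989253656363488797844781845786105899636530642950132124072139744611029730540886004033179839569820612692639548284214254118380650980531366750737323030898901242264800308971384555824152467454083916062823028110737093382107946451627096774328237806480764673669973886503223568427944010797624147239465473321640481180404468778958935085344761038726642914115047626329204367403291580451231436359194905460755132094533920970639456259592144551935),
  (8079251517827751825178719172167487990111025667428871008032586356881163784716972723299300352880728365922179490230474504873529889787622730273772038096612070780157719341825249022937549437597413026699014409596016892069197677020448000741408691898766350844375284305534790764160432334844699549599724056076497735495695098371527867614628585422076135178650571437154381122897806112990384554802839268173823275958054304599067746861673156557155080134316092674091266863101030079519859502529129718619756092515810391993228788354240295753713936899386617396697451387423840796810863131247166416672104865583477054312251237340455772826482,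
   8079193727695863663291493674077745133458137016242206446809420661292775449748033703022445498259375003351732706985631043814345761059516088994569901911570314192049468402816008897204492505973994755673591374489475501492175145516931309777968805281247916566785428018565089077104313831083476292576722333075566795214384528575777153572413274493167629338689423144926231124702746198201585680571755627234533574865541065447708365333720746103384092736284045214112293945821555486706478047661477913816425900824488876598202487289745873963214047120144230647631901769912777229185157129802114484638584451224801143244762492165880417353727),
  (8079251517827751825178719172167487990111025667428871008032586356881163784716972723299300352880728365922179490230474504873529889787622730273772038096612070780157111409196839649168695684455370903980087161742116894722425885865068364115917468632665289498847419183901251022904560695919320107300562181428629811736614489995862930481685971890340892760071754115784024889442521294045739094985599039937497862186885905770077516650527705541759659119122860104221489962150466883195458372089601781205218735707097468501964886363798404918761045315921991275499483110591196003052717200117611869408425530036645865191823118955800679077005,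
   8079251517827751825178719172167487990111025667428871008032586356881163784716972723299300352880728365922179490230474504873529889787622730273772038096612070780157432001424039655478862231869777610237758977680281809437463887786704606549894652865817020424681426031643861295239913136387545449649082593616391037250117358337948833685883296892648035976429562835356486089022314309926860411335254520194116965072439229283944881706662820636122728112517526350439871699576493289599504811025067721654121227447220560105800883233303607770702729507575064787620483629641435087083210798938900808780774837633548422211118862356556367790079),
  (8079251517827751825178719172167487990111025667428871008032586356881163784716972723299300352880728365922179490230474504873529889787622730273772038096612070780157177964415130575991405461583367830772370846225689621740628874744587558526095210088578472558292889940016823064180210236094953637980729713687908173521277100134126932158342905490656143937120530244475531767981644205301491557021516847147170482891083936212584801989719268286015801466443198166109536259207496944581593766657467823071814948227699892350599919757752984683932670055697873712110017687759351407264781562589493941866658563250498981304531247426299796413613,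
   8079251517827751825178719172167487990111025667428871008032586356881163784716972723299300352880728365922179490230474504873529889787622730273772038096612070780157144661024435813300270507460047806018211105598205311553675853107660119016821608295025031681163986047029656717448237155065316387224050911155538060133030484792179498301364367333095899562260126219143124145265390995809799415950487034073411764009334002003501944915269159762460025015950745408458444275298193345791018608446687431442449868953136486120267502688396875991627504295997756528995331994844605945153365942749459060899017618600253211459609528647465478127615),
  (8079251517827751825178719172167487990111025667428871008032586356881163784716972723299300352880728365922179490230474504873529889787622730273772038096612070780157719325335742141070864905951217862189853425867877479151631852045491805147677933696398711672053860519619660100249562411493938106812704080993588637961789818324586243543784357040239320203380498675605511106755161365213255865919913856674811548524898648122144423939537920133700503222553186779490284853491884856613088749514253205563953447263839990971429306755111708405583499392520481982843097235187964985911689907123700522891922427024305933510711867380341994217093,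
   8079251517827751825178719172167487990111025667428871008032586356881163784716972723299300352880728365922179490230474504873529889787622730273772038096612070780156570032834545375572886550608924523684711611405658151635705150948877601132486189924310709219694238280948800525246709418385889183795047750531522217002185106657424816130191827937865720969709111788456026392257213714159596172464720463281237596812798378045898842054140126830124505700306393328774832115208109893431408315496894117739396297386756952038374299613755011092408827804752742282076465505002819156989948613756021685609171802356689430453556955623315638059007),
  (8079251517827751825178719172167487990111025667428871008032586356881163784716972723299300352880728365922179373773719231842944323093940011943206770923956146578286301200006794170056676536823558544570754895718399630290321159190535355742765794383882646983305197913220836604483798582513645295532306379506662989639827877667767120441344420458528766005542574964944725271190809530622443145062561684658534679202562004879385617352118633046695292616786579057881416974138322164416167270582352582906872740580914645908569720625624808862406429338418647063563764721423117857138519929666844362678950179033892885328497255743741407970808,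
   8079251517827751825178719172167487990111025667428871008032586356881163784716972723299300352880728365922179435186989059377143811951920364984877772173050903494082816033493151239770559857818305893857928225577105048730419651937893535157460396864323076799716533805682513889596005808640775810011828007987998243878157389103141084256865434072644682327660449987144159263640533858568153036756041931775239891687781862189976206873161219291157795435965664417965547894405810161892824048488053155278658289340235557454557270887804637638654081766104297257377199531027904015855634870731667337883549773446417101313322194250746485014527),
  (8079251517827751825178719172167487990111025667428871008032586356881163784716972723299300352880728365922179386523166138368094354697110754809498545488025590226524260145422409465533502318484147735408744205011552547300153941456946491813527850165615711887898033518388944951374364828901693441546587594855845248566571441215925586998492486637215263676563494963221280393025366917801262216714740549923400142355198539242200690172777729528332790106387916436386005836752331406385005499935085246948875445697173972576977291113885479360395487364163090162319339017902634960912324035352403591133388832025505894434079854095284581200360,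
   8079251517827751825178719172167487990111025667428871008032586356881163784716972723299300352880728365922179380143503921438299295839011211072803736842760444185412667662548188182084203784638082770377297756579829494041902348584591288422481676798746592748569678528912458357991390557821322576832795197693384499401138361542551057895956107023785934643485580005163053373620476074754853243046711104793742685544668148116091610338741863377285305652830735916046783949393409948384449431396402260561222002034612339874931494310639483167059609041633531161291194510318905566464820175002588680242788182160141832049454102781155111600127),
  (8079251517827751825178719172167487990111025667428871008032586356881163784716972723299300352880728365922179490227315742902587629636601926136868946194399744643808510059608099193266303795023706020070745072443381573707908161320370817343532568534770198116371599677316102178407303257396235342037189418615784446501861049303474770464246809471176065758392892316575964196851950732413467234774603099272264637821575104605550861071861115698764770954138148324186557030092274948573278087213797039381700513619296761510486661552500845272561147166783384851192116164890812344856157137747777436213281292095288557119567326362336244736378,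
   8079251517827751825178719172167487990111025667428871008032586356881163784716972723299300352880728365922179270066611588571667647288471917637103607767095380884562429916403371009338644047414187538968418640981609175898322087235882607604662798812932339188981902058460736072371207503745881718002659711497039653117207567005052401321525520292931505957485768800878363951663510335555632156792722144611496592308293182131661005421285658598676617094965452181894911347405846425067019731889517902183409286909413890817831882604303268912734098829618757351307418092580987413644992799904988148276634997072632134972153381171151968927743),
  (8079251517827751825178719172167487990111025667428870985723904086927481092713434561912557013845615410696876198596226439708086378295734290460964294564124245725575518540238124600344279415007737001239418112284997242699387993555795182397885647895661932854153288953519290892164317873517033285068345626517674001922053169316794731876471619327759722398233943205247028335986910395141885909990094888896855352014912121762846154290021395242206957561770168761706512934221440191271530437895519757113517405565186558658786019968101522353976486128965433001142153794589261393137260914628639821230383110439830267015215048707037193995475,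
   8079251517827751825178719172167487990111025667428870997488349357013705594358664837671565533149921342156064121065501332694461982356452120114207769643330389278385464361279883684224259088067513989977817011032206656808800033993376011624206832705594967767324321098662587126373529510120373271334879289820389773375200262870947786291994172676069500654482198090753032335770723086911985776680966574954885281072506791066839669050745568109015808134600470735706908114988997356892683963709576447441784774547603021546703822007185238648602166062373539015147315386577584643832267494105689387552254819875922129425586086159534174240767),
  (8079251517827751825178719172167487990111025667428870988166212903522005261195202001813632733250844590067539826863982541868510684249905598355997433942595009240996213345467451843741706141677367345813751094980015396708068377503728351552036828843075414294025198566467217709005701810126471629513761376416955871670226117859338310740626285488550387485007909983808588929207179527431088713085186487804407976394662870691549780942508497824766569467660191897915845700617956503144127681866228990461657738901141945656649306904607776257883082390767595588954185067240068744447452553086944459407631049536599500568342473665082593611287,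
   8079251517827751825178719172167487990111025667428870986944112416062567529377289933938489574098640483951119446501202931718208300969518693563812259835465973495320761703331018923863925913814292503326628685175764985628631026949826200933708274794931975056475415402359878383530810224055226719835203762778108294240389919380235893435038592943447502238038659901145100401868639400979649605718041648676594582470668057742702992560767153337142324878827770337983741582065989056031926788271018789856652405904476851932878594506635416661215705842658628880611678085750394496667938866208516421805302823759973449492544526584317267148799),
  (8079251517827751825178719172167487990111025667428871008031981258301773064707497215227439545427281825110801246399823619158872085694478922838878407552847162763174188634694372213627608997988969420755473058327241077813744167784028348054640735699870692497976690643128118265174677564264599506648925408631543997238599547777426023016664332171874693053188179901340487994399883356106738012444287430468278681768485950087786730941718574823289259602923548934007158814660808120169347715339053713724788367937681124529495232814501990403008173859945869007928128280622030955834565855292369428283230457895494275756932364545995558593362,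
   8079251517827751825178719172167487990111025667428870965857569084500984648131399983728181422940356969691134733240818077502005578322111740580074368367059812802683622697544385888620619022416110699661467390935275043403612214441603259356954003294529709870884195084941062918875486221338135299887078126498931206423607215700074416443781334974873634733194572159672265353742233977716470005486077110100556860773290516319537516372522294237788901013105427516546022344794907854287917233430156388504920986228400641499847278925625129080679101942515952694756551147057218871840239004912519391249628723845862682475520454680599173529599),
  (3805757005165510055893730686330362088522774674287680118888401610657784006863881435882739988372920460114228109494307111174351405273853511849181044766047353382492445523307903317112051293441428412174552772175884032828760259786946645388281073686310844682395389463564451448676739754807941445156825493337575721602695924190468859755692195749036577174182988781880278040841024328957183189190145999279785605894477273082841015941558097866786582619308308090845069631540244432959473509246059650153965158658267315587506480823550340484887644491793240267151228489850124744337670716637618489945753517289309417913680053603174239533868,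
   6059376994811502124436762504298208711444395658610819663150904028286655664542638555172210499176246582152791690233009985624051522156826188614082852563306082944710670805890844548963571142550001750236942451968996110496398976380520463001089030755460013450880391128125092658414434177703945543965012218485935546146676159675009136133647636853772519188835286844643530928718887421701978628838196207691655607800013271422329733638411691991276531948715455285754015184778036027321101350244137465436998676403268090786241022521867054865121336281582787487205869988714275463368611536926466314946465058467485775246101405460917280309247),
  (4273610426521579339591240093589778492044098612640666737658064863511287159959185081333039232055219083752409917334487341334762383976146230516124915304494596539166512756437161877130551760458685721912931350377442787853701075443411217701421057055452303612710550807723283477565654850795949685934991334528468463603062765559138234459243286988693679812052054547251311505922268131419145516913902689932542544374796556452420735238437647801866034078560211284371355915223069300028984195070836222978800976138434345606200022701005755676209762945137520136403273559078766272156880745487199407302377682859867257131004872121336083069447,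
   4039502483081377158240727809637679800354379552732151329801095520387375647365586736532120830682727548874660523533869298775819913589014826339677500937917000340381823082352918007973789971570297464046866905203438852046278118047775731322055329670532737215510442907912922452986527140712278217134416580120598178674261578789030706040105437658965823439291392358641361322659166360521102838460655586518894143244005801460151696589253929591994851020389370863055979633019522345029125494580422668231884939728858691165023046385407319888077802793012834438974193819647229324719066700493173002915335494931875430551975460910804003454975),
  (8079135603968414254872467564414835399655178047929395201694367061485488338145663320327093251451760459869042372630767872630029873383210595279455946036406717141238953855947710205269397502675986494800476510401587527944503084371775613074453044735100917960658030396010263648955800215761455063562594470325487036570873041857338291455224671544380943083117360115785345634217003792180605762067935955602021218657578819753379426373809875288580367076298622807075769207387950845382640954655589302617106994008144168595162217746313720917977294731405681586623189078039911171135451226628289344513701308213519323471893762570989689973618,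
   123279594693416623309001452212028320161606226614820419434090978345965023570510448048390203138438848356966850131690589979149320828058208164577820405526917583925746449917987808577538290978964432170089941552673593096447405125156549907441713707361118778559503828752956712741156180203939902928464477147661936290939714981928713321726345958573707041313429166336002525903649105115924791682267995847451176521688756253435634627636754610380042897442288796353605840079970913840085894102306852786127725031125466661631508722777063939188029008706797663612071562211732210275485653163447663276487611384701353168355631914503110655)]

def common (l : List (ℕ × ℕ)) : ℕ :=
  List.rec (2 ^ 2080 - 1) (fun r _ ih => Nat.land (Nat.land r.1 r.2) ih) l

def count (l : List (ℕ × ℕ)) : ℕ → ℕ :=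
  List.rec (motive := fun _ => ℕ → ℕ)
    (fun s => Nat.rec (motive := fun _ => ℕ) 1 (fun _ _ => 0) s)
    (fun r l ih s => Nat.add
      (Nat.rec (motive := fun _ => ℕ) (ih (Nat.land s r.1)) (fun _ _ => 0)
        (Nat.land (Nat.land s r.1) (common l)))
      (Nat.rec (motive := fun _ => ℕ) (ih (Nat.land s r.2)) (fun _ _ => 0)
        (Nat.land (Nat.land s r.2) (common l)))) l

/-- The index of the point with barycentric coordinates those of `v` permuted by `s`. -/
def idx (s : List ℕ) (v : ℕ) : ℕ :=
  ((List.range 34).find? fun u => (List.range 4).all fun c =>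
    Nat.beq (bary u c) (bary v (s.getD c 0))).getD 0

def famSym (s : List ℕ) : List (ℕ × ℕ) := (List.range 34).map fun v => (2 ^ v, 2 ^ idx s v)

def symRows (s : List ℕ) : List (ℕ × ℕ) :=
  (List.range 34).map fun v =>
    ((famSym s).foldr (fun q acc => bif q.2.testBit v then 2 * acc else 2 * acc + 1)
        (rows.getD v 0).1,
      (famSym s).foldr (fun q acc => bif q.1.testBit v then 2 * acc else 2 * acc + 1)
        (rows.getD v 0).2)

/-- The state reached after leaving out the points `0, …, k - 1`. -/
def spine (k : ℕ) : ℕ := (rows.take k).foldl (fun s r => Nat.land s r.2) (2 ^ 2046 - 1)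

/-- The permutations of `{0, 1, 2, 3}` other than the identity, as lists of values. -/
def nontrivialPerms : List (List ℕ) := [
  [0, 1, 3, 2], [0, 2, 1, 3], [0, 2, 3, 1], [0, 3, 1, 2], [0, 3, 2, 1], [1, 0, 2, 3],
  [1, 0, 3, 2], [1, 2, 0, 3], [1, 2, 3, 0], [1, 3, 0, 2], [1, 3, 2, 0], [2, 0, 1, 3],
  [2, 0, 3, 1], [2, 1, 0, 3], [2, 1, 3, 0], [2, 3, 0, 1], [2, 3, 1, 0], [3, 0, 1, 2],
  [3, 0, 2, 1], [3, 1, 0, 2], [3, 1, 2, 0], [3, 2, 0, 1], [3, 2, 1, 0]]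

set_option maxRecDepth 100000

theorem length_fam_and_rows_eq : fam.length = 2046 ∧
    (List.range 34).map (fun v => (column Prod.snd fam v, column Prod.fst fam v)) = rows := by
  decide +kernel

theorem sum_count_symRows :
    (nontrivialPerms.map fun s => count (symRows s) (2 ^ 2080 - 1)).sum = 13377 := by
  decide +kernel

/-- The number of solutions whose first point has index `k`. -/
def firstCount (k : ℕ) : ℕ :=
  count (rows.drop (k + 1)) (Nat.land (spine k) (rows.getD k 0).1)

theorem sum_firstCount_0_2 : ((List.range' 0 2).map firstCount).sum = 54410 := by
  decide +kernel

theorem sum_firstCount_2_4 : ((List.range' 2 2).map firstCount).sum = 48017 := by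
  decide +kernel

theorem sum_firstCount_4_6 : ((List.range' 4 2).map firstCount).sum = 87748 := by
  decide +kernel

theorem sum_firstCount_6_9 : ((List.range' 6 3).map firstCount).sum = 75570 := by
  decide +kernel

theorem sum_firstCount_9_14 : ((List.range' 9 5).map firstCount).sum = 59857 := by
  decide +kernel

theorem count_spine : count (rows.drop 14) (spine 14) = 24357 := by decide +kernel

theorem perm_values : (Finset.univ : Finset (Equiv.Perm (Fin 4))).val.map
    (fun σ => (List.range 4).map fun c => (σ⁻¹ (Fin.ofNat 4 c)).val) =
      ↑([0, 1, 2, 3] :: nontrivialPerms) := by decide +kernel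

/-- The lists of Booleans that kill the state `s` along the rows `l`. -/
def sols : List (ℕ × ℕ) → ℕ → List (List Bool)
  | [], s => if s = 0 then [[]] else []
  | r :: l, s => (sols l (s &&& r.1)).map (true :: ·) ++ (sols l (s &&& r.2)).map (false :: ·)

theorem nodup_sols (l : List (ℕ × ℕ)) (s : ℕ) : (sols l s).Nodup := by
  induction l generalizing s with
  | nil => unfold sols; split <;> simp
  | cons r l ih =>
    rw [sols, List.nodup_append]
    refine ⟨(ih _).map fun _ _ h => by simpa using h, (ih _).map fun _ _ h => by simpa using h, ?_⟩
    simp only [List.mem_map]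
    rintro _ ⟨a, _, rfl⟩ _ ⟨b, _, rfl⟩
    simp

theorem mem_sols (l : List (ℕ × ℕ)) (s : ℕ) (b : List Bool) :
    b ∈ sols l s ↔ b.length = l.length ∧ ∀ w, s.testBit w = true → ∃ v < l.length,
      (bif b.getD v false then (l.getD v 0).1 else (l.getD v 0).2).testBit w = false := by
  induction l generalizing s b with
  | nil =>
    have h : (∀ w, s.testBit w = false) ↔ s = 0 :=
      ⟨fun h => Nat.eq_of_testBit_eq fun i => by simp [h], fun h => by simp [h]⟩
    rw [sols]
    split <;> simp_all
  | cons r l ih =>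
    cases b with
    | nil => simp [sols]
    | cons c b =>
      simp only [sols, List.mem_append, List.mem_map, ih, List.length_cons, Nat.exists_lt_succ_left,
        List.getD_cons_zero, List.getD_cons_succ, Nat.testBit_land, Bool.and_eq_true,
        List.cons.injEq]
      cases c <;> simp [imp_iff_not_or, or_assoc]

theorem common_cons (r : ℕ × ℕ) (l : List (ℕ × ℕ)) : common (r :: l) = r.1 &&& r.2 &&& common l :=
  rfl

theorem land_common_of_mem_sols {l : List (ℕ × ℕ)} {s : ℕ} {b : List Bool} (h : b ∈ sols l s) :
    s &&& common l = 0 := by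
  induction l generalizing s b with
  | nil =>
    rw [sols] at h
    split at h
    · subst s; exact Nat.zero_and (common [])
    · exact absurd h List.not_mem_nil
  | cons r l ih =>
    rw [common_cons]
    simp only [sols, List.mem_append, List.mem_map] at h
    rcases h with ⟨a, ha, -⟩ | ⟨a, ha, -⟩
    · have : s &&& r.1 &&& common l = 0 := ih ha
      rw [show s &&& ((r.1 &&& r.2) &&& common l) = (s &&& r.1 &&& common l) &&& r.2 by
        apply Nat.eq_of_testBit_eq; intro i; simp; grind, this, Nat.zero_and]
    · have : s &&& r.2 &&& common l = 0 := ih ha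
      rw [show s &&& ((r.1 &&& r.2) &&& common l) = (s &&& r.2 &&& common l) &&& r.1 by
        apply Nat.eq_of_testBit_eq; intro i; simp; grind, this, Nat.zero_and]

theorem pruned_eq_length_sols {l : List (ℕ × ℕ)} {t k : ℕ} (h : k = (sols l t).length) :
    Nat.rec (motive := fun _ => ℕ) k (fun _ _ => 0) (Nat.land t (common l)) =
      (sols l t).length := by
  rcases hn : Nat.land t (common l) with _ | n
  · exact h
  · symm
    rw [List.length_eq_zero_iff, List.eq_nil_iff_forall_not_mem]
    intro b hb
    exact absurd (hn.symm.trans (land_common_of_mem_sols hb)) (Nat.succ_ne_zero n)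

theorem count_eq_length_sols (l : List (ℕ × ℕ)) (s : ℕ) : count l s = (sols l s).length := by
  induction l generalizing s with
  | nil =>
    rcases s with _ | s
    · rfl
    · simp [count, sols]
  | cons r l ih =>
    rw [sols, List.length_append, List.length_map, List.length_map]
    exact congrArg₂ Nat.add (pruned_eq_length_sols (ih _)) (pruned_eq_length_sols (ih _))

theorem testBit_column (h : ℕ × ℕ → ℕ) (W : List (ℕ × ℕ)) (v w : ℕ) :
    (column h W v).testBit w = true ↔ w < W.length ∧ (h (W.getD w 0)).testBit v = false := by
  induction W generalizing w with
  | nil => simp [column]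
  | cons q W ih =>
    have hc : column h (q :: W) v =
        bif (h q).testBit v then 2 * column h W v else 2 * column h W v + 1 := rfl
    rw [hc]
    cases w with
    | zero => cases hq : (h q).testBit v <;> simp [hq, Nat.testBit_zero]
    | succ w => cases hq : (h q).testBit v <;>
        simp [Nat.testBit_add_one, ih, Nat.mul_add_div]

/-- The pattern `q = (I, O)` does not occur in `χ`: some point of `I` is missing, or some point of
`O` is present. -/
def Avoids (q : ℕ × ℕ) (χ : ℕ → Bool) : Prop :=
  ∃ v < 34, (bif χ v then q.2 else q.1).testBit v = true

theorem mem_sols_column (W : List (ℕ × ℕ)) (b : List Bool) :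
    b ∈ sols ((List.range 34).map fun v => (column Prod.snd W v, column Prod.fst W v))
      (2 ^ W.length - 1) ↔ b.length = 34 ∧ ∀ q ∈ W, Avoids q (b.getD · false) := by
  rw [mem_sols]
  simp only [List.length_map, List.length_range, Nat.testBit_two_pow_sub_one, decide_eq_true_eq]
  refine and_congr_right fun _ => ?_
  rw [List.forall_mem_iff_getElem]
  refine forall_congr' fun w => forall_congr' fun hw => exists_congr fun v =>
    and_congr_right fun hv => ?_
  rw [List.getD_eq_getElem (List.map _ _) _ (by simpa using hv)]
  simp only [List.getElem_map, List.getElem_range]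
  have h1 := testBit_column Prod.snd W v w
  have h2 := testBit_column Prod.fst W v w
  rw [List.getD_eq_getElem _ _ hw] at h1 h2
  cases b.getD v false
  · rw [← Bool.not_eq_true]; simp [h2, hw]
  · rw [← Bool.not_eq_true]; simp [h1, hw]

theorem mem_sols_rows (b : List Bool) : b ∈ sols rows (2 ^ 2046 - 1) ↔
    b.length = 34 ∧ ∀ q ∈ fam, Avoids q (b.getD · false) := by
  rw [← mem_sols_column, length_fam_and_rows_eq.2, length_fam_and_rows_eq.1]

theorem idx_lt (s : List ℕ) (v : ℕ) : idx s v < 34 := by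
  unfold idx
  rcases h : List.find? _ (List.range 34) with _ | u
  · simp
  · simpa using List.mem_of_find?_eq_some h

theorem mem_sols_symRows (s : List ℕ) (b : List Bool) : b ∈ sols (symRows s) (2 ^ 2080 - 1) ↔
    b.length = 34 ∧ (∀ q ∈ fam, Avoids q (b.getD · false)) ∧
      ∀ v < 34, b.getD v false = true → b.getD (idx s v) false = true := by
  have hr : symRows s = (List.range 34).map fun v =>
      (column Prod.snd (famSym s ++ fam) v, column Prod.fst (famSym s ++ fam) v) := by
    refine List.map_congr_left fun v hv => ?_
    have : rows.getD v 0 = (column Prod.snd fam v, column Prod.fst fam v) := by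
      rw [← length_fam_and_rows_eq.2, List.getD_eq_getElem _ _ (by simpa using hv)]; simp
    rw [this]
    simp only [column, List.foldr_append]
  have hl : (famSym s ++ fam).length = 2080 := by
    rw [List.length_append, length_fam_and_rows_eq.1, famSym, List.length_map, List.length_range]
  rw [hr, ← hl, mem_sols_column, List.forall_mem_append, and_comm (b := ∀ q ∈ fam, _)]
  refine and_congr_right fun _ => and_congr_right fun _ => ?_
  simp only [famSym, List.forall_mem_map, List.mem_range]
  refine forall₂_congr fun v hv => ?_
  have hx : idx s v < 34 := idx_lt s v
  simp only [Avoids, Bool.cond_eq_ite]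
  constructor
  · rintro ⟨u, hu, h⟩ h'
    by_cases hb : b.getD u false = true
    · rw [if_pos hb, Nat.testBit_two_pow] at h
      simpa [of_decide_eq_true h] using hb
    · rw [if_neg hb, Nat.testBit_two_pow] at h
      exact absurd (of_decide_eq_true h ▸ h') hb
  · intro h
    by_cases hb : b.getD v false = true
    · exact ⟨idx s v, hx, by rw [if_pos (h hb), Nat.testBit_two_pow_self]⟩
    · exact ⟨v, hv, by rw [if_neg hb, Nat.testBit_two_pow_self]⟩

theorem length_sols_drop (k : ℕ) (hk : k < rows.length) :
    (sols (rows.drop k) (spine k)).length =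
      firstCount k + (sols (rows.drop (k + 1)) (spine (k + 1))).length := by
  have h : spine (k + 1) = spine k &&& (rows.getD k 0).2 := by
    rw [spine, List.take_add_one, List.getElem?_eq_getElem hk, Option.toList_some,
      List.foldl_append, List.getD_eq_getElem _ _ hk]
    rfl
  rw [List.drop_eq_getElem_cons hk, sols, List.length_append, List.length_map, List.length_map, h,
    firstCount, count_eq_length_sols, List.getD_eq_getElem _ _ hk]
  rfl

theorem eq_sum_add_of_step {f g : ℕ → ℕ} {n : ℕ} (h : ∀ k < n, f k = g k + f (k + 1)) (k : ℕ)
    (hk : k ≤ n) : f 0 = ((List.range k).map g).sum + f k := by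
  induction k with
  | zero => simp
  | succ k ih =>
    rw [ih (by omega), h k (by omega), List.range_succ, List.map_append, List.sum_append,
      List.map_singleton, List.sum_singleton, add_assoc]

theorem length_rows : rows.length = 34 := by
  rw [← length_fam_and_rows_eq.2, List.length_map, List.length_range]

theorem spine_zero : spine 0 = 2 ^ 2046 - 1 := by
  rw [spine, List.take_zero, List.foldl_nil]

theorem sum_firstCount : ((List.range 14).map firstCount).sum = 325602 := by
  have h : List.range 14 = List.range' 0 2 ++ List.range' 2 2 ++ List.range' 4 2 ++
      List.range' 6 3 ++ List.range' 9 5 := rfl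
  rw [h, List.map_append, List.map_append, List.map_append, List.map_append, List.sum_append,
    List.sum_append, List.sum_append, List.sum_append, sum_firstCount_0_2, sum_firstCount_2_4,
    sum_firstCount_4_6, sum_firstCount_6_9, sum_firstCount_9_14]

theorem length_sols_rows : (sols rows (2 ^ 2046 - 1)).length = 349959 := by
  obtain ⟨f, hf⟩ : ∃ f : ℕ → ℕ, ∀ k, f k = (sols (rows.drop k) (spine k)).length :=
    ⟨_, fun _ => rfl⟩
  have h := eq_sum_add_of_step (f := f) (g := firstCount) (n := rows.length)
    (fun k hk => by rw [hf, hf]; exact length_sols_drop k hk) 14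
    (by rw [length_rows]; norm_num)
  rw [hf, hf, ← count_eq_length_sols (rows.drop 14), count_spine, sum_firstCount, List.drop_zero,
    spine_zero] at h
  exact h

/-- The real point with the given integer coordinates. -/
def toR (u : ℤ × ℤ × ℤ) : Fin 3 → ℝ := ![u.1, u.2.1, u.2.2]

def ptR (v : ℕ) : Fin 3 → ℝ := toR (pt v)

/-- The barycentric coordinates with respect to `4Δ₃`, scaled to have sum `4`. -/
def baryR (x : Fin 3 → ℝ) : Fin 4 → ℝ := ![x 0, x 1, x 2, 4 - x 0 - x 1 - x 2]

theorem dotp_three (a x : Fin 3 → ℝ) : dotp a x = a 0 * x 0 + a 1 * x 1 + a 2 * x 2 :=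
  Fin.sum_univ_three _

theorem toR_ctr : toR ctr = pOne := by
  simp [toR, ctr, pOne]

theorem dotp_toR (u v : ℤ × ℤ × ℤ) : dotp (toR u) (toR v) = dot u v := by
  simp [dotp_three, toR, dot]

theorem dotp_toR_sub (u v w : ℤ × ℤ × ℤ) :
    dotp (toR u) (toR v) - dotp (toR u) (toR w) = dot u (sub v w) := by
  simp [dotp_three, toR, dot, sub]; ring

theorem isLinearMap_dotp (a : Fin 3 → ℝ) : IsLinearMap ℝ (dotp a) :=
  ⟨fun x y => by simp [dotp_three]; ring, fun c x => by simp [dotp_three]; ring⟩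

theorem le_dotp_of_mem_convexHull {S : Set (Fin 3 → ℝ)} {a : Fin 3 → ℝ} {b : ℝ}
    (h : ∀ x ∈ S, b ≤ dotp a x) : ∀ x ∈ convexHull ℝ S, b ≤ dotp a x :=
  convexHull_min h (convex_halfSpace_ge (isLinearMap_dotp a) b)

theorem eq_of_forall_dotp {f : (Fin 3 → ℝ) →ₗ[ℝ] ℝ} (x : Fin 3 → ℝ) :
    f x = dotp (fun i => f (Pi.single i 1)) x := by
  conv_lhs => rw [← Finset.univ_sum_single x]
  rw [map_sum, dotp]
  refine Finset.sum_congr rfl fun i _ => ?_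
  rw [show Pi.single i (x i) = x i • (Pi.single i 1 : Fin 3 → ℝ) by
    rw [← Pi.single_smul, smul_eq_mul, mul_one], map_smul, smul_eq_mul, mul_comm]

theorem exists_dotp_lt_of_mem_interior {S : Set (Fin 3 → ℝ)} {p a : Fin 3 → ℝ}
    (hp : p ∈ interior (convexHull ℝ S)) (ha : a ≠ 0) : ∃ x ∈ S, dotp a x < dotp a p := by
  by_contra! h
  have hc : Filter.Tendsto (fun t : ℝ => p - t • a) (nhdsWithin 0 (Ioi 0)) (nhds p) := by
    have : Continuous fun t : ℝ => p - t • a := by fun_prop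
    simpa using (this.tendsto 0).mono_left nhdsWithin_le_nhds
  obtain ⟨t, ht, ht0⟩ := ((hc.eventually (mem_interior_iff_mem_nhds.1 hp)).and
    self_mem_nhdsWithin).exists
  have h1 := le_dotp_of_mem_convexHull h _ ht
  have h2 : 0 < a 0 ^ 2 + a 1 ^ 2 + a 2 ^ 2 := by
    by_contra! h3
    refine ha (funext fun i => ?_)
    fin_cases i <;> simp <;> nlinarith [sq_nonneg (a 0), sq_nonneg (a 1), sq_nonneg (a 2)]
  simp only [dotp_three, Pi.sub_apply, Pi.smul_apply, smul_eq_mul] at h1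
  nlinarith [mul_pos (mem_Ioi.1 ht0) h2]

theorem mem_interior_of_forall_exists_dotp_lt {S : Set (Fin 3 → ℝ)} {p : Fin 3 → ℝ}
    (h : ∀ a ≠ 0, ∃ x ∈ S, dotp a x < dotp a p) : p ∈ interior (convexHull ℝ S) := by
  have key : ∀ f : (Fin 3 → ℝ) →ₗ[ℝ] ℝ, f ≠ 0 → ∃ x ∈ S, f x < f p := by
    intro f hf
    obtain ⟨x, hx, hlt⟩ := h (fun i => f (Pi.single i 1)) fun h0 => hf <| LinearMap.ext fun x => by
      rw [eq_of_forall_dotp, h0]; simp [dotp]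
    exact ⟨x, hx, by rwa [eq_of_forall_dotp x, eq_of_forall_dotp p]⟩
  have hne : (interior (convexHull ℝ S)).Nonempty := by
    rw [(convex_convexHull ℝ S).interior_nonempty_iff_affineSpan_eq_top, affineSpan_convexHull]
    by_contra hS
    obtain ⟨x₀, hx₀, -⟩ := h 1 one_ne_zero
    have hd : (affineSpan ℝ S).direction ≠ ⊤ := fun hd => hS <|
      (AffineSubspace.direction_eq_top_iff_of_nonempty ⟨x₀, subset_affineSpan ℝ S hx₀⟩).1 hd
    obtain ⟨f, hf, hker⟩ := Submodule.exists_le_ker_of_lt_top _ (lt_top_iff_ne_top.2 hd)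
    have hconst : ∀ x ∈ S, f x = f x₀ := fun x hx => by
      have : x -ᵥ x₀ ∈ (affineSpan ℝ S).direction := AffineSubspace.vsub_mem_direction
        (subset_affineSpan ℝ S hx) (subset_affineSpan ℝ S hx₀)
      have := hker this
      rwa [LinearMap.mem_ker, vsub_eq_sub, map_sub, sub_eq_zero] at this
    obtain ⟨x, hx, hlt⟩ := key f hf
    obtain ⟨y, hy, hlt'⟩ := key (-f) (neg_ne_zero.2 hf)
    rw [hconst x hx] at hlt
    rw [LinearMap.neg_apply, LinearMap.neg_apply, hconst y hy] at hlt'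
    linarith
  by_contra hp
  obtain ⟨f, hf⟩ := geometric_hahn_banach_open_point (convex_convexHull ℝ S).interior
    isOpen_interior hp
  have hf0 : (f : (Fin 3 → ℝ) →ₗ[ℝ] ℝ) ≠ 0 := by
    rintro h0
    obtain ⟨x, hx⟩ := hne
    have := hf x hx
    have hz : ∀ y, f y = 0 := fun y => LinearMap.congr_fun h0 y
    simp [hz] at this
  obtain ⟨x, hx, hlt⟩ := key (-f) (neg_ne_zero.2 hf0)
  have hcl : x ∈ closure (interior (convexHull ℝ S)) := by
    rw [(convex_convexHull ℝ S).closure_interior_eq_closure_of_nonempty_interior hne]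
    exact subset_closure (subset_convexHull ℝ S hx)
  have : f x ≤ f p := closure_minimal (s := interior (convexHull ℝ S)) (t := {y | f y ≤ f p})
    (fun y hy => (hf y hy).le) (isClosed_le f.continuous continuous_const) hcl
  simp at hlt
  linarith

theorem toR_sub (u v : ℤ × ℤ × ℤ) : toR (sub u v) = toR u - toR v := by
  ext i; fin_cases i <;> simp [toR, sub]

theorem toR_cross (u v : ℤ × ℤ × ℤ) : toR (cross u v) = crossProduct (toR u) (toR v) := by
  ext i; fin_cases i <;> simp [toR, cross, cross_apply]

theorem toR_injective : Function.Injective toR := by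
  intro u v h
  have h0 := congrFun h 0
  have h1 := congrFun h 1
  have h2 := congrFun h 2
  simp only [toR, Matrix.cons_val, Int.cast_inj] at h0 h1 h2
  exact Prod.ext h0 (Prod.ext h1 h2)

theorem toR_zero : toR 0 = 0 := by
  ext i; fin_cases i <;> simp [toR]

theorem dotp_self_pos {a : Fin 3 → ℝ} (ha : a ≠ 0) : 0 < dotp a a := by
  rw [dotp_three]
  by_contra! h
  refine ha (funext fun i => ?_)
  fin_cases i <;> simp <;> nlinarith [mul_self_nonneg (a 0), mul_self_nonneg (a 1),
    mul_self_nonneg (a 2)]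

theorem dotp_sub (a x y : Fin 3 → ℝ) : dotp a (x - y) = dotp a x - dotp a y := by
  simp [dotp_three]; ring

theorem dotp_add_smul (a d x : Fin 3 → ℝ) (t : ℝ) :
    dotp (a + t • d) x = dotp a x + t * dotp d x := by
  simp [dotp_three]; ring

/-- A covector orthogonal to two vectors is parallel to their cross product. -/
theorem dotp_cross_mul {a v w : Fin 3 → ℝ} (hv : dotp a v = 0) (hw : dotp a w = 0) (i : Fin 3) :
    dotp (crossProduct v w) (crossProduct v w) * a i =
      dotp a (crossProduct v w) * crossProduct v w i := by
  rw [dotp_three] at hv hw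
  fin_cases i <;> simp only [dotp_three, cross_apply, Matrix.cons_val, Fin.zero_eta, Fin.mk_one,
    Fin.reduceFinMk]
  · linear_combination ((v 2 * w 0 - v 0 * w 2) * v 2 - (v 0 * w 1 - v 1 * w 0) * v 1) * hw -
      ((v 2 * w 0 - v 0 * w 2) * w 2 - (v 0 * w 1 - v 1 * w 0) * w 1) * hv
  · linear_combination ((v 0 * w 1 - v 1 * w 0) * v 0 - (v 1 * w 2 - v 2 * w 1) * v 2) * hw -
      ((v 0 * w 1 - v 1 * w 0) * w 0 - (v 1 * w 2 - v 2 * w 1) * w 2) * hv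
  · linear_combination ((v 1 * w 2 - v 2 * w 1) * v 1 - (v 2 * w 0 - v 0 * w 2) * v 0) * hw -
      ((v 1 * w 2 - v 2 * w 1) * w 1 - (v 2 * w 0 - v 0 * w 2) * w 0) * hv

theorem exists_eq_smul_cross {a v w : Fin 3 → ℝ} (hv : dotp a v = 0) (hw : dotp a w = 0)
    (hn : crossProduct v w ≠ 0) : ∃ c : ℝ, a = c • crossProduct v w := by
  refine ⟨dotp a (crossProduct v w) / dotp (crossProduct v w) (crossProduct v w),
    funext fun i => ?_⟩
  have h := dotp_cross_mul hv hw i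
  have h0 := (dotp_self_pos hn).ne'
  rw [Pi.smul_apply, smul_eq_mul]
  field_simp
  linarith

theorem dotp_smul_left (c : ℝ) (a x : Fin 3 → ℝ) : dotp (c • a) x = c * dotp a x := by
  simp [dotp_three]; ring

theorem exists_ne_zero_dotp_eq_zero (a : Fin 3 → ℝ) : ∃ d ≠ 0, dotp a d = 0 := by
  by_cases h : a 0 = 0
  · exact ⟨![1, 0, 0], fun h => by simpa using congrFun h 0, by simp [dotp_three, h]⟩
  · exact ⟨![-a 1, a 0, 0], fun h' => h (by simpa using congrFun h' 1), by
      simp [dotp_three]; ring⟩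

theorem ptR_sub_ne_zero {v : ℕ} (hv : v < 34) : ptR v - pOne ≠ 0 := by
  have h : ∀ v < 34, pt v ≠ ctr := by decide +kernel
  rw [sub_ne_zero, ← toR_ctr]
  exact fun h' => h v hv (toR_injective h')

theorem exists_dotp_ptR_ne_zero {d : Fin 3 → ℝ} (hd : d ≠ 0) :
    ∃ l < 34, dotp d (ptR l - pOne) ≠ 0 := by
  by_contra! h
  have e0 : pt 0 = (0, 0, 0) := by decide +kernel
  have e1 : pt 1 = (0, 0, 4) := by decide +kernel
  have e2 : pt 2 = (0, 4, 0) := by decide +kernel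
  have e3 : pt 3 = (4, 0, 0) := by decide +kernel
  have h0 := h 0 (by norm_num)
  have h1 := h 1 (by norm_num)
  have h2 := h 2 (by norm_num)
  have h3 := h 3 (by norm_num)
  simp [dotp_three, ptR, toR, pOne, e0, e1, e2, e3] at h0 h1 h2 h3
  refine hd (funext fun i => ?_)
  fin_cases i <;> simp <;> linarith

/-- Moving a covector in the direction `d` until it vanishes on a new point. -/
theorem exists_tight_step (a : Fin 3 → ℝ) {d : Fin 3 → ℝ} (hd : d ≠ 0) :
    ∃ (t : ℝ) (l : ℕ), l < 34 ∧ dotp d (ptR l - pOne) ≠ 0 ∧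
      dotp (a + t • d) (ptR l - pOne) = 0 ∧
      ∀ m < 34, 0 ≤ dotp a (ptR m - pOne) → 0 ≤ dotp (a + t • d) (ptR m - pOne) := by
  classical
  obtain ⟨l₀, hl₀, hdl₀⟩ := exists_dotp_ptR_ne_zero hd
  obtain ⟨l, hl, hmin⟩ := Finset.exists_min_image
    ((Finset.range 34).filter fun l => dotp d (ptR l - pOne) ≠ 0)
    (fun l => |dotp a (ptR l - pOne) / dotp d (ptR l - pOne)|)
    ⟨l₀, by simp [hl₀, hdl₀]⟩
  simp only [Finset.mem_filter, Finset.mem_range] at hl hmin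
  refine ⟨-(dotp a (ptR l - pOne) / dotp d (ptR l - pOne)), l, hl.1, hl.2, ?_, fun m hm h => ?_⟩
  · rw [dotp_add_smul]; field_simp [hl.2]; ring
  · rw [dotp_add_smul]
    by_cases hdm : dotp d (ptR m - pOne) = 0
    · rw [hdm]; linarith
    · have h1 := hmin m ⟨hm, hdm⟩
      rw [abs_div (dotp a (ptR m - pOne)), le_div_iff₀ (abs_pos.2 hdm), ← abs_mul,
        abs_of_nonneg h] at h1
      have := (abs_le.1 h1).2
      linarith

theorem exists_rays {a : Fin 3 → ℝ} (ha : a ≠ 0) : ∃ i < 34, ∃ j < 34, rays i j ≠ 0 ∧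
    ∀ m < 34, 0 ≤ dotp a (ptR m - pOne) → 0 ≤ dotp (toR (rays i j)) (ptR m - pOne) := by
  have hne : ∀ {a d : Fin 3 → ℝ} (t : ℝ), a ≠ 0 → dotp a d = 0 → a + t • d ≠ 0 := by
    intro a d t ha had h
    have h1 := dotp_self_pos ha
    have h2 : dotp a (a + t • d) = dotp a a + t * dotp a d := by simp [dotp_three]; ring
    rw [h, had] at h2
    simp [dotp] at h2 h1
    linarith
  obtain ⟨d, hd, had⟩ := exists_ne_zero_dotp_eq_zero a
  obtain ⟨t, i, hi, -, hti, hm⟩ := exists_tight_step a hd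
  have ha' := hne t ha had
  generalize a + t • d = a' at *
  have hcross : crossProduct a' (ptR i - pOne) ≠ 0 := by
    intro h0
    refine (mul_pos (dotp_self_pos ha') (dotp_self_pos (ptR_sub_ne_zero hi))).ne' ?_
    generalize ptR i - pOne = v at *
    have h1 := congrFun h0 0
    have h2 := congrFun h0 1
    have h3 := congrFun h0 2
    simp only [cross_apply, Matrix.cons_val, Pi.zero_apply] at h1 h2 h3
    rw [dotp_three] at hti ⊢
    rw [dotp_three]
    linear_combination (a' 0 * v 0 + a' 1 * v 1 + a' 2 * v 2) * hti +
      (a' 1 * v 2 - a' 2 * v 1) * h1 + (a' 2 * v 0 - a' 0 * v 2) * h2 +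
      (a' 0 * v 1 - a' 1 * v 0) * h3
  obtain ⟨s, j, hj, hdj, hsj, hm'⟩ := exists_tight_step a' hcross
  have hsi : dotp (a' + s • crossProduct a' (ptR i - pOne)) (ptR i - pOne) = 0 := by
    rw [dotp_add_smul, hti]
    simp [dotp_three, cross_apply]; ring_nf; simp
  have ha'' := hne s ha' (d := crossProduct a' (ptR i - pOne)) (by
    simp [dotp_three, cross_apply]; ring)
  generalize a' + s • crossProduct a' (ptR i - pOne) = b at *
  have hn : crossProduct (ptR i - pOne) (ptR j - pOne) ≠ 0 := by
    intro h0
    refine hdj ?_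
    have : dotp (crossProduct a' (ptR i - pOne)) (ptR j - pOne) =
        dotp a' (crossProduct (ptR i - pOne) (ptR j - pOne)) := by
      simp only [dotp_three, cross_apply, Matrix.cons_val]; ring
    rw [this, h0]; simp [dotp]
  have hrays : ∀ i j, toR (rays i j) = crossProduct (ptR i - pOne) (ptR j - pOne) := fun i j => by
    rw [rays, toR_cross, toR_sub, toR_sub, toR_ctr]; rfl
  have hne0 : ∀ i j, crossProduct (ptR i - pOne) (ptR j - pOne) ≠ 0 → rays i j ≠ 0 :=
    fun i j h h0 => h (by rw [← hrays, h0, toR_zero])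
  obtain ⟨c, hc⟩ := exists_eq_smul_cross hsi hsj hn
  have hb : ∀ m < 34, 0 ≤ dotp a (ptR m - pOne) →
      0 ≤ c * dotp (crossProduct (ptR i - pOne) (ptR j - pOne)) (ptR m - pOne) :=
    fun m hm34 h => by rw [← dotp_smul_left, ← hc]; exact hm' m hm34 (hm m hm34 h)
  rcases lt_trichotomy c 0 with h | h | h
  · have hanti : crossProduct (ptR j - pOne) (ptR i - pOne) =
        (-1 : ℝ) • crossProduct (ptR i - pOne) (ptR j - pOne) := by
      rw [neg_one_smul, cross_anticomm]
    refine ⟨j, hj, i, hi, hne0 _ _ ?_, fun m hm34 hm0 => ?_⟩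
    · rw [hanti, neg_one_smul, neg_ne_zero]; exact hn
    · rw [hrays, hanti, dotp_smul_left]
      nlinarith [hb m hm34 hm0]
  · rw [h, zero_smul] at hc; exact absurd hc ha''
  · refine ⟨i, hi, j, hj, hne0 _ _ hn, fun m hm34 hm0 => ?_⟩
    rw [hrays]
    exact nonneg_of_mul_nonneg_right (hb m hm34 hm0) h

theorem testBit_mask (p : ℕ → Bool) (l : ℕ) : (mask p).testBit l = true ↔ l < 34 ∧ p l = true := by
  have h : ∀ n s l, ((List.range' s n).foldr
      (fun l acc => bif p l then 2 * acc + 1 else 2 * acc) 0).testBit l = true ↔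
        l < n ∧ p (s + l) = true := by
    intro n
    induction n with
    | zero => simp
    | succ n ih =>
      intro s l
      rw [List.range'_succ, List.foldr_cons]
      cases l with
      | zero => cases p s <;> simp [Nat.testBit_zero]
      | succ l =>
        have := ih (s + 1) l
        rw [show s + 1 + l = s + (l + 1) by ring] at this
        cases p s <;> simp [Nat.testBit_add_one, this, Nat.mul_add_div]
  simpa [mask, List.range_eq_range'] using h 34 0 l

theorem avoids_iff (q : ℕ × ℕ) (χ : ℕ → Bool) : Avoids q χ ↔
    ((∀ v < 34, q.1.testBit v = true → χ v = true) →
      ∃ l < 34, q.2.testBit l = true ∧ χ l = true) := by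
  constructor
  · rintro ⟨v, hv, h⟩ hI
    cases hχ : χ v <;> rw [hχ] at h
    · exact absurd (hI v hv h) (by simp [hχ])
    · exact ⟨v, hv, h, hχ⟩
  · intro h
    by_cases hI : ∀ v < 34, q.1.testBit v = true → χ v = true
    · obtain ⟨l, hl, hO, hχ⟩ := h hI
      exact ⟨l, hl, by simpa [hχ] using hO⟩
    · push Not at hI
      obtain ⟨v, hv, hq, hχ⟩ := hI
      exact ⟨v, hv, by simpa [hχ] using hq⟩

theorem testBit_two_pow_add {i j : ℕ} (h : i < j) (v : ℕ) :
    (2 ^ i + 2 ^ j).testBit v = true ↔ v = i ∨ v = j := by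
  have h1 := Nat.two_pow_add_eq_or_of_lt (Nat.pow_lt_pow_right one_lt_two h) 1
  rw [mul_one] at h1
  rw [add_comm, h1, Nat.testBit_or, Nat.testBit_two_pow, Nat.testBit_two_pow]
  simp only [Bool.or_eq_true, decide_eq_true_eq]
  tauto

theorem testBit_two_pow_add_add {i j k : ℕ} (hij : i < j) (hjk : j < k) (v : ℕ) :
    (2 ^ i + 2 ^ j + 2 ^ k).testBit v = true ↔ v = i ∨ v = j ∨ v = k := by
  have hlt : 2 ^ i + 2 ^ j < 2 ^ k := by
    have h1 : 2 ^ i < 2 ^ j := Nat.pow_lt_pow_right one_lt_two hij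
    have h2 : 2 ^ (j + 1) ≤ 2 ^ k := Nat.pow_le_pow_right two_pos hjk
    rw [pow_succ] at h2
    omega
  have h1 := Nat.two_pow_add_eq_or_of_lt hlt 1
  rw [mul_one] at h1
  rw [add_comm, h1, Nat.testBit_or, Nat.testBit_two_pow, Bool.or_eq_true, testBit_two_pow_add hij,
    decide_eq_true_eq]
  tauto

theorem avoids_zero_mask (p : ℕ → Bool) (χ : ℕ → Bool) :
    Avoids (0, mask p) χ ↔ ∃ l < 34, p l = true ∧ χ l = true := by
  simp only [avoids_iff, testBit_mask]
  constructor
  · rintro h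
    obtain ⟨l, hl, ⟨-, hp⟩, hχ⟩ := h (by simp)
    exact ⟨l, hl, hp, hχ⟩
  · rintro ⟨l, hl, hp, hχ⟩ -
    exact ⟨l, hl, ⟨hl, hp⟩, hχ⟩

/-- The polytope spanned by `(1, 1, 1)` and the boundary points selected by `χ`. -/
def hull (χ : ℕ → Bool) : Set (Fin 3 → ℝ) :=
  convexHull ℝ (insert pOne {x | ∃ v < 34, χ v = true ∧ x = ptR v})

theorem pOne_mem_hull (χ : ℕ → Bool) : pOne ∈ hull χ :=
  subset_convexHull ℝ _ (mem_insert _ _)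

theorem ptR_mem_hull {χ : ℕ → Bool} {v : ℕ} (hv : v < 34) (h : χ v = true) : ptR v ∈ hull χ :=
  subset_convexHull ℝ _ (mem_insert_of_mem _ ⟨v, hv, h, rfl⟩)

theorem forall_famInt (χ : ℕ → Bool) : (∀ q ∈ famInt, Avoids q χ) ↔
    ∀ i < 34, ∀ j < 34, rays i j ≠ 0 →
      ∃ l < 34, dot (rays i j) (sub (pt l) ctr) < 0 ∧ χ l = true := by
  have hd : ∀ (L : List ℕ) (q : ℕ × ℕ), q ∈ L.foldr
      (fun m acc => bif acc.any fun q => Nat.beq q.2 m then acc else (0, m) :: acc)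
      ([] : List (ℕ × ℕ)) ↔ ∃ m ∈ L, q = (0, m) := by
    intro L
    induction L with
    | nil => simp
    | cons m L ih =>
      intro q
      rw [List.foldr_cons]
      cases hany : List.any (List.foldr _ _ L) _
      · simp [ih]
      · rw [cond_true, ih]
        simp only [List.any_eq_true, ih] at hany
        obtain ⟨_, ⟨m', hm', rfl⟩, he⟩ := hany
        have : m' = m := Nat.eq_of_beq_eq_true he
        subst this
        constructor
        · rintro ⟨a, ha, rfl⟩; exact ⟨a, by simp [ha], rfl⟩
        · rintro ⟨a, ha, rfl⟩
          rcases List.mem_cons.1 ha with rfl | ha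
          · exact ⟨_, hm', rfl⟩
          · exact ⟨a, ha, rfl⟩
  constructor
  · intro h i hi j hj hn
    have := h (0, mask fun l => decide (dot (rays i j) (sub (pt l) ctr) < 0)) ((hd _ _).2 ⟨_, by
      simp only [List.mem_flatMap, List.mem_range]
      exact ⟨i, hi, j, hj, by
        rw [decide_eq_false (show ¬rays i j = (0, 0, 0) from hn)]
        exact List.mem_singleton_self _⟩, rfl⟩)
    simpa only [avoids_zero_mask, decide_eq_true_eq] using this
  · intro h q hq
    obtain ⟨m, hm, rfl⟩ := (hd _ _).1 hq
    simp only [List.mem_flatMap, List.mem_range] at hm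
    obtain ⟨i, hi, j, hj, hm⟩ := hm
    by_cases hn : rays i j = (0, 0, 0)
    · simp [hn] at hm
    · rw [decide_eq_false hn, cond_false, List.mem_singleton] at hm
      subst hm
      simpa only [avoids_zero_mask, decide_eq_true_eq] using h i hi j hj hn

theorem famInt_iff (χ : ℕ → Bool) :
    (∀ q ∈ famInt, Avoids q χ) ↔ pOne ∈ interior (hull χ) := by
  rw [forall_famInt]
  have hdot : ∀ i j l, dotp (toR (rays i j)) (ptR l - pOne) =
      dot (rays i j) (sub (pt l) ctr) := fun i j l => by
    rw [← dotp_toR_sub, dotp_sub, ← toR_ctr, ptR]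
  constructor
  · intro h
    refine mem_interior_of_forall_exists_dotp_lt fun a ha => ?_
    by_contra! hc
    obtain ⟨i, hi, j, hj, hn, hm⟩ := exists_rays ha
    obtain ⟨l, hl, hneg, hχ⟩ := h i hi j hj hn
    have h1 := hm l hl (by
      rw [dotp_sub, sub_nonneg]
      exact hc _ (mem_insert_of_mem _ ⟨l, hl, hχ, rfl⟩))
    rw [hdot] at h1
    exact absurd hneg (not_lt.2 (by exact_mod_cast h1))
  · intro h i hi j hj hn
    have ha : toR (rays i j) ≠ 0 := fun h0 => hn (toR_injective (h0.trans toR_zero.symm))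
    obtain ⟨x, hx, hlt⟩ := exists_dotp_lt_of_mem_interior h ha
    rcases hx with rfl | ⟨l, hl, hχ, rfl⟩
    · exact absurd hlt (lt_irrefl _)
    · refine ⟨l, hl, ?_, hχ⟩
      rw [← sub_neg, ← dotp_sub, hdot] at hlt
      exact_mod_cast hlt

theorem forall_famRef (χ : ℕ → Bool) : (∀ q ∈ famRef, Avoids q χ) ↔
    ∀ k < 34, ∀ j < k, ∀ i < j, badTriple i j k = true → χ i = true → χ j = true → χ k = true →
      ∃ l < 34, dst i j k * dot (nrm i j k) (sub (pt l) (pt i)) < 0 ∧ χ l = true := by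
  have hav : ∀ (p : ℕ → Bool) i j k, i < j → j < k → k < 34 →
      (Avoids (2 ^ i + 2 ^ j + 2 ^ k, mask p) χ ↔
        (χ i = true → χ j = true → χ k = true → ∃ l < 34, p l = true ∧ χ l = true)) := by
    intro p i j k hij hjk hk
    have h1 : (∃ l < 34, (l < 34 ∧ p l = true) ∧ χ l = true) ↔
        ∃ l < 34, p l = true ∧ χ l = true :=
      exists_congr fun l => by tauto
    simp only [avoids_iff, testBit_mask, testBit_two_pow_add_add hij hjk, h1]
    constructor
    · intro h hi hj hk'
      exact h (by rintro v - (rfl | rfl | rfl) <;> assumption)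
    · intro h hI
      exact h (hI i (by omega) (by simp)) (hI j (by omega) (by simp)) (hI k hk (by simp))
  constructor
  · intro h k hk j hj i hi hb
    have := h _ (by
      simp only [famRef, List.mem_flatMap, List.mem_range]
      exact ⟨k, hk, j, hj, i, hi, by rw [hb]; exact List.mem_singleton_self _⟩)
    simpa only [hav _ i j k hi hj hk, decide_eq_true_eq] using this
  · intro h q hq
    simp only [famRef, List.mem_flatMap, List.mem_range] at hq
    obtain ⟨k, hk, j, hj, i, hi, hq⟩ := hq
    cases hb : badTriple i j k
    · simp [hb] at hq
    · rw [hb, cond_true, List.mem_singleton] at hq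
      subst hq
      simpa only [hav _ i j k hi hj hk, decide_eq_true_eq] using h k hk j hj i hi hb

theorem exists_pos_combination_on_face {S : Set (Fin 3 → ℝ)} {a : Fin 3 → ℝ} {b : ℝ}
    (h : ∀ x ∈ S, b ≤ dotp a x) {x : Fin 3 → ℝ} (hx : x ∈ convexHull ℝ S) (hb : dotp a x = b) :
    ∃ (ι : Type) (_ : Fintype ι) (z : ι → Fin 3 → ℝ) (w : ι → ℝ),
      (∀ i, z i ∈ S ∧ dotp a (z i) = b) ∧ AffineIndependent ℝ z ∧ (∀ i, 0 < w i) ∧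
        ∑ i, w i = 1 ∧ ∑ i, w i • z i = x := by
  obtain ⟨ι, hι, z, w, hz, hind, hw, hw1, hwz⟩ := eq_pos_convex_span_of_mem_convexHull hx
  refine ⟨ι, hι, z, w, fun i => ⟨hz ⟨i, rfl⟩, ?_⟩, hind, hw, hw1, hwz⟩
  have hsum : ∑ i, w i * (dotp a (z i) - b) = 0 := by
    have h1 : dotp a x = ∑ i, w i * dotp a (z i) := by
      rw [← hwz]
      have := map_sum (IsLinearMap.mk' _ (isLinearMap_dotp a)) (fun i => w i • z i) Finset.univ
      simpa only [IsLinearMap.mk'_apply, (isLinearMap_dotp a).map_smul, smul_eq_mul] using this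
    simp only [mul_sub, Finset.sum_sub_distrib, ← Finset.sum_mul, hw1, ← h1, hb]
    ring
  have h0 := (Finset.sum_eq_zero_iff_of_nonneg fun i _ =>
    mul_nonneg (hw i).le (sub_nonneg.2 (h _ (hz ⟨i, rfl⟩)))).1 hsum i (Finset.mem_univ i)
  rcases mul_eq_zero.1 h0 with h0 | h0
  · exact absurd h0 (hw i).ne'
  · linarith

theorem convexHull_inter_face {S : Set (Fin 3 → ℝ)} {a : Fin 3 → ℝ} {b : ℝ}
    (h : ∀ x ∈ S, b ≤ dotp a x) :
    convexHull ℝ S ∩ {x | dotp a x = b} ⊆ convexHull ℝ (S ∩ {x | dotp a x = b}) := by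
  rintro x ⟨hx, hb⟩
  obtain ⟨ι, _, z, w, hz, -, hw, hw1, rfl⟩ := exists_pos_combination_on_face h hx hb
  exact (convex_convexHull ℝ _).sum_mem (fun i _ => (hw i).le) hw1
    fun i _ => subset_convexHull ℝ _ (hz i)

theorem exists_smul_of_cross_eq_zero {v w : Fin 3 → ℝ} (hv : v ≠ 0) (h : crossProduct v w = 0) :
    ∃ c : ℝ, w = c • v := by
  refine ⟨dotp v w / dotp v v, funext fun i => ?_⟩
  have h0 := (dotp_self_pos hv).ne'
  have h1 := congrFun h 0
  have h2 := congrFun h 1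
  have h3 := congrFun h 2
  simp only [cross_apply, Matrix.cons_val, Pi.zero_apply] at h1 h2 h3
  rw [Pi.smul_apply, smul_eq_mul, eq_comm, div_mul_eq_mul_div, div_eq_iff h0]
  simp only [dotp_three]
  fin_cases i <;> simp only [Fin.zero_eta, Fin.mk_one, Fin.reduceFinMk]
  · linear_combination v 1 * h3 - v 2 * h2
  · linear_combination v 2 * h1 - v 0 * h3
  · linear_combination v 0 * h2 - v 1 * h1

theorem exists_cross_ne_zero {S : Set (Fin 3 → ℝ)}
    (h : Module.finrank ℝ (affineSpan ℝ S).direction = 2) :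
    ∃ x ∈ S, ∃ y ∈ S, ∃ z ∈ S, crossProduct (y - x) (z - x) ≠ 0 := by
  by_contra! hc
  rcases S.eq_empty_or_nonempty with rfl | ⟨x, hx⟩
  · rw [AffineSubspace.span_empty, AffineSubspace.direction_bot, finrank_bot] at h
    omega
  obtain ⟨v, hv⟩ : ∃ v : Fin 3 → ℝ, ∀ z ∈ S, ∃ c : ℝ, z - x = c • v := by
    by_cases hS : ∀ z ∈ S, z = x
    · exact ⟨0, fun z hz => ⟨0, by simp [hS z hz]⟩⟩
    · push Not at hS
      obtain ⟨y, hy, hyx⟩ := hS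
      exact ⟨y - x, fun z hz => exists_smul_of_cross_eq_zero (sub_ne_zero.2 hyx)
        (hc x hx y hy z hz)⟩
  have hle : (affineSpan ℝ S).direction ≤ Submodule.span ℝ {v} := by
    rw [direction_affineSpan, vectorSpan_eq_span_vsub_set_right ℝ hx, Submodule.span_le]
    rintro _ ⟨z, hz, rfl⟩
    obtain ⟨c, hc⟩ := hv z hz
    exact Submodule.mem_span_singleton.2 ⟨c, hc.symm⟩
  have h1 := Submodule.finrank_mono hle
  have h2 := finrank_span_le_card (R := ℝ) ({v} : Set (Fin 3 → ℝ))
  simp at h2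
  omega

theorem finrank_eq_two_of_cross_ne_zero {D : Submodule ℝ (Fin 3 → ℝ)} {u v : Fin 3 → ℝ}
    (hu : u ∈ D) (hv : v ∈ D) (h : crossProduct u v ≠ 0) {a : Fin 3 → ℝ} (ha : a ≠ 0)
    (hD : ∀ x ∈ D, dotp a x = 0) : Module.finrank ℝ D = 2 := by
  have h1 : Module.finrank ℝ D < 3 := by
    have hlt : D < ⊤ := lt_top_iff_ne_top.2 fun ht => by
      have := hD a (ht ▸ Submodule.mem_top)
      exact (dotp_self_pos ha).ne' this
    simpa using Submodule.finrank_lt hlt.ne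
  have h2 : ¬Module.finrank ℝ D ≤ 1 := fun hle => by
    obtain ⟨w, hw⟩ := finrank_le_one_iff.1 hle
    obtain ⟨c, hc⟩ := hw ⟨u, hu⟩
    obtain ⟨d, hd⟩ := hw ⟨v, hv⟩
    refine h ?_
    have hc' : c • (w : Fin 3 → ℝ) = u := congrArg Subtype.val hc
    have hd' : d • (w : Fin 3 → ℝ) = v := congrArg Subtype.val hd
    rw [← hc', ← hd']
    simp
  omega

theorem badTriple_iff (i j k : ℕ) : badTriple i j k = true ↔ dst i j k ≠ 0 ∧
    ¬(dst i j k ∣ (nrm i j k).1 ∧ dst i j k ∣ (nrm i j k).2.1 ∧ dst i j k ∣ (nrm i j k).2.2) := by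
  simp only [badTriple, Bool.and_eq_true, Bool.not_eq_true', decide_eq_false_iff_not,
    Int.dvd_iff_emod_eq_zero, Bool.and_eq_false_iff, not_and_or, or_assoc, ne_eq]

theorem toR_nrm (i j k : ℕ) :
    toR (nrm i j k) = crossProduct (ptR j - ptR i) (ptR k - ptR i) := by
  rw [nrm, toR_cross, toR_sub, toR_sub]; rfl

theorem dotp_nrm_sub_ptR (i j k l : ℕ) : dotp (toR (nrm i j k)) (ptR l) -
    dotp (toR (nrm i j k)) (ptR i) = dot (nrm i j k) (sub (pt l) (pt i)) :=
  dotp_toR_sub _ _ _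

theorem dotp_nrm_sub_pOne (i j k : ℕ) : dotp (toR (nrm i j k)) pOne -
    dotp (toR (nrm i j k)) (ptR i) = dst i j k := by
  rw [← toR_ctr]; exact dotp_toR_sub _ _ _

theorem dotp_cross_left (u v : Fin 3 → ℝ) : dotp (crossProduct u v) u = 0 := by
  simp only [dotp_three, cross_apply, Matrix.cons_val]; ring

theorem dotp_cross_right (u v : Fin 3 → ℝ) : dotp (crossProduct u v) v = 0 := by
  simp only [dotp_three, cross_apply, Matrix.cons_val]; ring

theorem exists_sorted {P : ℕ → ℕ → ℕ → Prop} (h₁ : ∀ u v w, P u v w → P v u w)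
    (h₂ : ∀ u v w, P u v w → P u w v) (h₀ : ∀ u v, ¬P u u v) {u v w : ℕ} (h : P u v w) :
    ∃ i j k, i < j ∧ j < k ∧ P i j k := by
  have huv : u ≠ v := by rintro rfl; exact h₀ _ _ h
  have hvw : v ≠ w := by rintro rfl; exact h₀ _ _ (h₁ _ _ _ (h₂ _ _ _ (h₁ _ _ _ h)))
  have huw : u ≠ w := by rintro rfl; exact h₀ _ _ (h₂ _ _ _ h)
  rcases huv.lt_or_gt with a | a <;> rcases hvw.lt_or_gt with b | b <;>
    rcases huw.lt_or_gt with c | c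
  · exact ⟨u, v, w, a, b, h⟩
  · omega
  · exact ⟨u, w, v, c, b, h₂ _ _ _ h⟩
  · exact ⟨w, u, v, c, a, h₁ _ _ _ (h₂ _ _ _ h)⟩
  · exact ⟨v, u, w, a, c, h₁ _ _ _ h⟩
  · exact ⟨v, w, u, b, c, h₂ _ _ _ (h₁ _ _ _ h)⟩
  · omega
  · exact ⟨w, v, u, b, a, h₁ _ _ _ (h₂ _ _ _ (h₁ _ _ _ h))⟩

theorem forall_famRef_of_isReflexive {χ : ℕ → Bool} (h : IsReflexive (hull χ) pOne) :
    ∀ q ∈ famRef, Avoids q χ := by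
  rw [forall_famRef]
  intro k hk j hj i hi hbad hχi hχj hχk
  obtain ⟨hd, hnd⟩ := (badTriple_iff i j k).1 hbad
  by_contra! hneg
  have hd' : (dst i j k : ℝ) ≠ 0 := by exact_mod_cast hd
  have hn : crossProduct (ptR j - ptR i) (ptR k - ptR i) ≠ 0 := by
    intro h0
    have := dotp_nrm_sub_pOne i j k
    rw [toR_nrm, h0] at this
    simp [dotp] at this
    exact hd' this.symm
  have hi34 : i < 34 := by omega
  have hj34 : j < 34 := by omega
  set a : Fin 3 → ℝ := (dst i j k : ℝ) • toR (nrm i j k) with ha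
  have ha0 : a ≠ 0 := smul_ne_zero hd' (by rwa [toR_nrm])
  have haj : dotp a (ptR j) = dotp a (ptR i) := by
    rw [← sub_eq_zero, ← dotp_sub, ha, toR_nrm, dotp_smul_left, dotp_cross_left, mul_zero]
  have hak : dotp a (ptR k) = dotp a (ptR i) := by
    rw [← sub_eq_zero, ← dotp_sub, ha, toR_nrm, dotp_smul_left, dotp_cross_right, mul_zero]
  have hle : ∀ x ∈ hull χ, dotp a (ptR i) ≤ dotp a x := by
    refine le_dotp_of_mem_convexHull ?_
    rintro x (rfl | ⟨l, hl, hχ, rfl⟩)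
    · rw [← sub_nonneg, ha, dotp_smul_left, dotp_smul_left, ← mul_sub, dotp_nrm_sub_pOne]
      exact mul_self_nonneg _
    · rw [← sub_nonneg, ha, dotp_smul_left, dotp_smul_left, ← mul_sub, dotp_nrm_sub_ptR]
      by_contra! hlt
      exact hneg l hl (by exact_mod_cast hlt) hχ
  set F := hull χ ∩ {x | dotp a x = dotp a (ptR i)} with hF
  have hFi : ptR i ∈ F := ⟨ptR_mem_hull hi34 hχi, rfl⟩
  have hFj : ptR j ∈ F := ⟨ptR_mem_hull hj34 hχj, haj⟩
  have hFk : ptR k ∈ F := ⟨ptR_mem_hull hk hχk, hak⟩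
  have hdir : ∀ x ∈ F, x - ptR i ∈ (affineSpan ℝ F).direction := fun x hx =>
    AffineSubspace.vsub_mem_direction (subset_affineSpan ℝ F hx) (subset_affineSpan ℝ F hFi)
  have hker : ∀ x ∈ (affineSpan ℝ F).direction, dotp a x = 0 := by
    have : (affineSpan ℝ F).direction ≤ LinearMap.ker (IsLinearMap.mk' _ (isLinearMap_dotp a)) := by
      rw [direction_affineSpan, vectorSpan_eq_span_vsub_set_right ℝ hFi, Submodule.span_le]
      rintro _ ⟨z, hz, rfl⟩
      change dotp a (z - ptR i) = 0
      rw [dotp_sub, sub_eq_zero]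
      exact hz.2
    exact fun x hx => this hx
  obtain ⟨a', b', h1, -, h3⟩ := h F ⟨a, _, hle, hF,
    finrank_eq_two_of_cross_ne_zero (hdir _ hFj) (hdir _ hFk) hn ha0 hker⟩
  obtain ⟨c, hc⟩ := exists_eq_smul_cross (a := fun i => (a' i : ℝ))
    (by rw [dotp_sub, h1 _ hFj, h1 _ hFi, sub_self])
    (by rw [dotp_sub, h1 _ hFk, h1 _ hFi, sub_self]) hn
  have hcd : c * dst i j k = 1 := by
    rw [← dotp_nrm_sub_pOne, toR_nrm, mul_sub, ← dotp_smul_left, ← dotp_smul_left, ← hc, h3,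
      h1 _ hFi]
    ring
  have hdvd : ∀ (m : Fin 3) (n : ℤ), toR (nrm i j k) m = n → dst i j k ∣ n := fun m n hmn => by
    refine ⟨a' m, ?_⟩
    have h5 : (a' m : ℝ) = c * n := by
      rw [← hmn, toR_nrm]; exact congrFun hc m
    have : (n : ℝ) = dst i j k * a' m := by rw [h5]; linear_combination (-(n : ℝ)) * hcd
    exact_mod_cast this
  exact hnd ⟨hdvd 0 _ rfl, hdvd 1 _ rfl, hdvd 2 _ rfl⟩

theorem isReflexive_of_forall_famRef {χ : ℕ → Bool} (hint : pOne ∈ interior (hull χ))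
    (h : ∀ q ∈ famRef, Avoids q χ) : IsReflexive (hull χ) pOne := by
  rw [forall_famRef] at h
  rintro F ⟨a, b, hle, rfl, hfr⟩
  have hgen : ∀ x ∈ insert pOne {x | ∃ v < 34, χ v = true ∧ x = ptR v}, b ≤ dotp a x :=
    fun x hx => hle x (subset_convexHull ℝ _ hx)
  have ha : a ≠ 0 := by
    rintro rfl
    have h0 : ∀ x : Fin 3 → ℝ, dotp (0 : Fin 3 → ℝ) x = 0 := fun x => by simp [dotp]
    by_cases hb : 0 = b
    · have ht : affineSpan ℝ (hull χ) = ⊤ :=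
        (convex_convexHull ℝ _).interior_nonempty_iff_affineSpan_eq_top.1 ⟨_, hint⟩
      rw [show hull χ ∩ {x | dotp 0 x = b} = hull χ by ext; simp [h0, hb], ht,
        AffineSubspace.direction_top, finrank_top] at hfr
      simp at hfr
    · rw [show hull χ ∩ {x | dotp 0 x = b} = ∅ by ext; simp [h0, hb],
        AffineSubspace.span_empty, AffineSubspace.direction_bot, finrank_bot] at hfr
      omega
  have hp : b < dotp a pOne := by
    obtain ⟨x, hx, hlt⟩ := exists_dotp_lt_of_mem_interior hint ha
    exact (hgen x hx).trans_lt hlt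
  have hFs : affineSpan ℝ (hull χ ∩ {x | dotp a x = b}) =
      affineSpan ℝ (insert pOne {x | ∃ v < 34, χ v = true ∧ x = ptR v} ∩ {x | dotp a x = b}) := by
    refine le_antisymm ?_ (affineSpan_mono ℝ (inter_subset_inter_left _ (subset_convexHull ℝ _)))
    rw [← affineSpan_convexHull (𝕜 := ℝ) (insert pOne _ ∩ _)]
    exact affineSpan_mono ℝ (convexHull_inter_face hgen)
  rw [hFs] at hfr
  have hmem : ∀ x ∈ insert pOne {x | ∃ v < 34, χ v = true ∧ x = ptR v} ∩ {x | dotp a x = b},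
      ∃ v < 34, χ v = true ∧ x = ptR v ∧ dotp a (ptR v) = b := by
    rintro x ⟨rfl | ⟨v, hv, hχ, rfl⟩, hb⟩
    · exact absurd hb hp.ne'
    · exact ⟨v, hv, hχ, rfl, hb⟩
  obtain ⟨x, hx, y, hy, z, hz, hxyz⟩ := exists_cross_ne_zero hfr
  obtain ⟨u, hu, hχu, rfl, hbu⟩ := hmem x hx
  obtain ⟨v, hv, hχv, rfl, hbv⟩ := hmem y hy
  obtain ⟨w, hw, hχw, rfl, hbw⟩ := hmem z hz
  let T : ℕ → Prop := fun v => v < 34 ∧ χ v = true ∧ dotp a (ptR v) = b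
  obtain ⟨i, j, k, hij, hjk, ⟨hi, hχi, hbi⟩, ⟨hj, hχj, hbj⟩, ⟨hk, hχk, hbk⟩, hn⟩ :=
    exists_sorted (P := fun i j k => T i ∧ T j ∧ T k ∧
        crossProduct (ptR j - ptR i) (ptR k - ptR i) ≠ 0)
      (fun u v w ⟨hu, hv, hw, hc⟩ => ⟨hv, hu, hw, fun h0 => hc (by
        have : crossProduct (ptR v - ptR u) (ptR w - ptR u) =
          -crossProduct (ptR u - ptR v) (ptR w - ptR v) := by
          ext i; fin_cases i <;> simp [cross_apply] <;> ring
        rw [this, h0, neg_zero])⟩)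
      (fun u v w ⟨hu, hv, hw, hc⟩ => ⟨hu, hw, hv, fun h0 => hc (by
        rw [← neg_eq_zero, cross_anticomm]; exact h0)⟩)
      (fun u v ⟨_, _, _, hc⟩ => hc (by simp))
      (u := u) (v := v) (w := w) ⟨⟨hu, hχu, hbu⟩, ⟨hv, hχv, hbv⟩, ⟨hw, hχw, hbw⟩, hxyz⟩
  obtain ⟨c, hc⟩ := exists_eq_smul_cross (by rw [dotp_sub, hbj, hbi, sub_self])
    (by rw [dotp_sub, hbk, hbi, sub_self]) hn
  rw [← toR_nrm] at hc
  have hcx : ∀ x, dotp a x - b = c * (dotp (toR (nrm i j k)) x -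
      dotp (toR (nrm i j k)) (ptR i)) := fun x => by
    rw [mul_sub, ← dotp_smul_left, ← dotp_smul_left, ← hc, hbi]
  have hcd : 0 < c * dst i j k := by
    rw [← dotp_nrm_sub_pOne, ← hcx]; linarith
  have hd : dst i j k ≠ 0 := by
    rintro h0; simp [h0] at hcd
  have hnb : ¬badTriple i j k = true := fun hb => by
    obtain ⟨l, hl, hneg, hχl⟩ := h k hk j hjk i hij hb hχi hχj hχk
    have h1 := hgen _ (mem_insert_of_mem _ ⟨l, hl, hχl, rfl⟩)
    have h2 := hcx (ptR l)
    rw [dotp_nrm_sub_ptR] at h2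
    have h3 : (dst i j k : ℝ) * dot (nrm i j k) (sub (pt l) (pt i)) < 0 := by exact_mod_cast hneg
    have h4 : 0 ≤ c * (dot (nrm i j k) (sub (pt l) (pt i)) : ℝ) := by linarith
    nlinarith [mul_nonneg hcd.le h4, mul_pos_iff.1 hcd, mul_self_nonneg c,
      mul_neg_of_pos_of_neg (pow_pos (abs_pos.2 (left_ne_zero_of_mul hcd.ne')) 2) h3, sq_abs c]
  have hdv : dst i j k ∣ (nrm i j k).1 ∧ dst i j k ∣ (nrm i j k).2.1 ∧
      dst i j k ∣ (nrm i j k).2.2 := by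
    by_contra hnd
    exact hnb ((badTriple_iff i j k).2 ⟨hd, hnd⟩)
  obtain ⟨⟨n₀, h₀⟩, ⟨n₁, h₁⟩, ⟨n₂, h₂⟩⟩ := hdv
  have hN : toR (nrm i j k) = (dst i j k : ℝ) • toR (n₀, n₁, n₂) := by
    ext m; fin_cases m <;> simp [toR, h₀, h₁, h₂]
  have hcast : (fun m => ((![n₀, n₁, n₂] m : ℤ) : ℝ)) = toR (n₀, n₁, n₂) := by
    ext m; fin_cases m <;> simp [toR]
  have hbi' : ((dot (n₀, n₁, n₂) (pt i) : ℤ) : ℝ) = dotp (toR (n₀, n₁, n₂)) (ptR i) :=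
    (dotp_toR _ _).symm
  simp only [hN, dotp_smul_left, ← mul_sub] at hcx
  have hdR : (dst i j k : ℝ) ≠ 0 := by exact_mod_cast hd
  refine ⟨![n₀, n₁, n₂], dot (n₀, n₁, n₂) (pt i), ?_, ?_, ?_⟩ <;> rw [hcast, hbi']
  · rintro x ⟨-, hx⟩
    have := hcx x
    rw [show dotp a x = b from hx, sub_self, ← mul_assoc, eq_comm, mul_eq_zero] at this
    rcases this with h | h
    · exact absurd h hcd.ne'
    · linarith
  · intro x hx
    have h1 := hcx x
    rw [← mul_assoc] at h1
    have := hle x hx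
    by_contra! hlt
    nlinarith
  · have h1 := dotp_nrm_sub_pOne i j k
    rw [hN, dotp_smul_left, dotp_smul_left, ← mul_sub] at h1
    have := mul_left_cancel₀ hdR (h1.trans (mul_one _).symm)
    linarith

theorem baryR_ptR {v : ℕ} (hv : v < 34) (c : Fin 4) : baryR (ptR v) c = bary v c := by
  have h : ∀ v < 34, bary v 0 + bary v 1 + bary v 2 + bary v 3 = 4 := by decide +kernel
  have hs : (bary v 0 + bary v 1 + bary v 2 + bary v 3 : ℝ) = 4 := by exact_mod_cast h v hv
  fin_cases c <;> simp [baryR, ptR, toR, pt]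
  linarith

theorem baryR_pOne (c : Fin 4) : baryR pOne c = 1 := by
  have h : pOne 0 = 1 ∧ pOne 1 = 1 ∧ pOne 2 = 1 := ⟨rfl, rfl, rfl⟩
  fin_cases c <;> norm_num [baryR, h]

theorem co_cast {v : ℕ} (hv : v < 34) (f c : ℕ) :
    (co f c v : ℝ) = baryR (ptR v) (Fin.ofNat 4 (f + c)) := by
  rw [baryR_ptR hv, co]; simp

theorem ptR_injOn {u v : ℕ} (hu : u < 34) (hv : v < 34) (h : ptR u = ptR v) : u = v := by
  have : ∀ u < 34, ∀ v < 34, pt u = pt v → u = v := by decide +kernel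
  exact this u hu v hv (toR_injective h)

theorem exists_baryR_eq (f : Fin 4) : ∃ (a : Fin 3 → ℝ) (b : ℝ), ∀ x, baryR x f = dotp a x - b := by
  fin_cases f
  · exact ⟨![1, 0, 0], 0, fun x => by simp [baryR, dotp_three]⟩
  · exact ⟨![0, 1, 0], 0, fun x => by simp [baryR, dotp_three]⟩
  · exact ⟨![0, 0, 1], 0, fun x => by simp [baryR, dotp_three]⟩
  · exact ⟨![-1, -1, -1], -4, fun x => by simp [baryR, dotp_three]; ring⟩

theorem baryR_add {s t : ℝ} (h : s + t = 1) (x y : Fin 3 → ℝ) (c : Fin 4) :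
    baryR (s • x + t • y) c = s * baryR x c + t * baryR y c := by
  fin_cases c <;> simp [baryR]
  linear_combination (-4) * h

theorem baryR_add_add {r s t : ℝ} (h : r + s + t = 1) (x y z : Fin 3 → ℝ) (c : Fin 4) :
    baryR (r • x + s • y + t • z) c = r * baryR x c + s * baryR y c + t * baryR z c := by
  fin_cases c <;> simp [baryR]
  linear_combination (-4) * h

theorem eq_of_baryR_eq (f : ℕ) {x y : Fin 3 → ℝ}
    (h0 : baryR x (Fin.ofNat 4 f) = baryR y (Fin.ofNat 4 f))
    (h1 : baryR x (Fin.ofNat 4 (f + 1)) = baryR y (Fin.ofNat 4 (f + 1)))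
    (h2 : baryR x (Fin.ofNat 4 (f + 2)) = baryR y (Fin.ofNat 4 (f + 2))) : x = y := by
  have e1 : Fin.ofNat 4 (f + 1) = Fin.ofNat 4 f + 1 := by
    ext; simp [Fin.val_add]
  have e2 : Fin.ofNat 4 (f + 2) = Fin.ofNat 4 f + 2 := by
    ext; simp [Fin.val_add]
  rw [e1] at h1
  rw [e2] at h2
  revert h0 h1 h2
  generalize Fin.ofNat 4 f = c
  intro h0 h1 h2
  ext i
  fin_cases c <;> fin_cases i <;> simp [baryR] at h0 h1 h2 ⊢ <;> linarith

theorem mem_face {f v : ℕ} : v ∈ face f ↔ v < 34 ∧ bary v f = 0 := by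
  simp [face]

theorem forall_famSeg (χ : ℕ → Bool) : (∀ q ∈ famSeg, Avoids q χ) ↔
    ∀ f < 4, ∀ j ∈ face f, ∀ i ∈ face f, i < j → ∀ y ∈ face f, onSeg f i j y = true →
      χ i = true → χ j = true → χ y = true := by
  have hav : ∀ i j y, i < j → j < 34 → y < 34 → (Avoids (2 ^ i + 2 ^ j, 2 ^ y) χ ↔
      (χ i = true → χ j = true → χ y = true)) := by
    intro i j y hij hj hy
    simp only [avoids_iff, testBit_two_pow_add hij, Nat.testBit_two_pow, decide_eq_true_eq]
    constructor
    · intro h hi hj'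
      obtain ⟨l, -, rfl, h⟩ := h (by rintro v - (rfl | rfl) <;> assumption)
      exact h
    · exact fun h h' => ⟨y, hy, rfl, h (h' i (by omega) (.inl rfl)) (h' j hj (.inr rfl))⟩
  constructor
  · intro h f hf j hj i hi hij y hy hs
    refine (hav i j y hij (mem_face.1 hj).1 (mem_face.1 hy).1).1 (h _ ?_)
    simp only [famSeg, List.mem_flatMap, List.mem_range]
    refine ⟨f, hf, j, hj, i, hi, ?_⟩
    rw [show Nat.blt i j = true by simpa using hij, cond_true, List.mem_flatMap]
    exact ⟨y, hy, by rw [hs]; simp⟩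
  · intro h q hq
    simp only [famSeg, List.mem_flatMap, List.mem_range] at hq
    obtain ⟨f, hf, j, hj, i, hi, hq⟩ := hq
    cases hb : Nat.blt i j <;> rw [hb] at hq
    · simp at hq
    rw [cond_true, List.mem_flatMap] at hq
    obtain ⟨y, hy, hq⟩ := hq
    cases hs : onSeg f i j y <;> rw [hs] at hq
    · simp at hq
    rw [cond_true, List.mem_singleton] at hq
    have hij : i < j := by simpa using hb
    subst hq
    exact (hav i j y hij (mem_face.1 hj).1 (mem_face.1 hy).1).2 (h f hf j hj i hi hij y hy hs)

theorem forall_famTri (χ : ℕ → Bool) : (∀ q ∈ famTri, Avoids q χ) ↔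
    ∀ f < 4, ∀ k ∈ face f, ∀ j ∈ face f, j < k → ∀ i ∈ face f, i < j → ∀ y ∈ face f,
      inTri f i j k y = true → χ i = true → χ j = true → χ k = true → χ y = true := by
  have hav : ∀ i j k y, i < j → j < k → k < 34 → y < 34 →
      (Avoids (2 ^ i + 2 ^ j + 2 ^ k, 2 ^ y) χ ↔
        (χ i = true → χ j = true → χ k = true → χ y = true)) := by
    intro i j k y hij hjk hk hy
    simp only [avoids_iff, testBit_two_pow_add_add hij hjk, Nat.testBit_two_pow, decide_eq_true_eq]
    constructor
    · intro h hi hj' hk'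
      obtain ⟨l, -, rfl, h⟩ := h (by rintro v - (rfl | rfl | rfl) <;> assumption)
      exact h
    · exact fun h h' => ⟨y, hy, rfl, h (h' i (by omega) (.inl rfl))
        (h' j (by omega) (.inr (.inl rfl))) (h' k hk (.inr (.inr rfl)))⟩
  constructor
  · intro h f hf k hk j hj hjk i hi hij y hy hs
    refine (hav i j k y hij hjk (mem_face.1 hk).1 (mem_face.1 hy).1).1 (h _ ?_)
    simp only [famTri, List.mem_flatMap, List.mem_range]
    refine ⟨f, hf, k, hk, j, hj, ?_⟩
    rw [show Nat.blt j k = true by simpa using hjk, cond_true, List.mem_flatMap]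
    refine ⟨i, hi, ?_⟩
    rw [show Nat.blt i j = true by simpa using hij, cond_true, List.mem_flatMap]
    exact ⟨y, hy, by rw [hs]; simp⟩
  · intro h q hq
    simp only [famTri, List.mem_flatMap, List.mem_range] at hq
    obtain ⟨f, hf, k, hk, j, hj, hq⟩ := hq
    cases hb : Nat.blt j k <;> rw [hb] at hq
    · simp at hq
    rw [cond_true, List.mem_flatMap] at hq
    obtain ⟨i, hi, hq⟩ := hq
    cases hb' : Nat.blt i j <;> rw [hb'] at hq
    · simp at hq
    rw [cond_true, List.mem_flatMap] at hq
    obtain ⟨y, hy, hq⟩ := hq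
    cases hs : inTri f i j k y <;> rw [hs] at hq
    · simp at hq
    rw [cond_true, List.mem_singleton] at hq
    have hjk : j < k := by simpa using hb
    have hij : i < j := by simpa using hb'
    subst hq
    exact (hav i j k y hij hjk (mem_face.1 hk).1 (mem_face.1 hy).1).2
      (h f hf k hk j hj hjk i hi hij y hy hs)

theorem baryR_of_mem_face {f v : ℕ} (hf : f < 4) (h : v ∈ face f) :
    baryR (ptR v) (Fin.ofNat 4 f) = 0 := by
  rw [baryR_ptR (mem_face.1 h).1]
  simp [Nat.mod_eq_of_lt hf, (mem_face.1 h).2]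

/-- Twice the signed area of a triangle in the chart of a facet of `4Δ₃`. -/
def areaR (f : ℕ) (x y z : Fin 3 → ℝ) : ℝ :=
  (baryR y (Fin.ofNat 4 (f + 1)) - baryR x (Fin.ofNat 4 (f + 1))) *
      (baryR z (Fin.ofNat 4 (f + 2)) - baryR x (Fin.ofNat 4 (f + 2))) -
    (baryR y (Fin.ofNat 4 (f + 2)) - baryR x (Fin.ofNat 4 (f + 2))) *
      (baryR z (Fin.ofNat 4 (f + 1)) - baryR x (Fin.ofNat 4 (f + 1)))

theorem area_cast {f i j k : ℕ} (hi : i < 34) (hj : j < 34) (hk : k < 34) :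
    (area f i j k : ℝ) = areaR f (ptR i) (ptR j) (ptR k) := by
  simp only [area, areaR]
  push_cast
  simp only [co_cast, hi, hj, hk]

theorem area_swap_left (f i j k : ℕ) : area f j i k = -area f i j k := by
  simp only [area]; ring

theorem area_swap_right (f i j k : ℕ) : area f i k j = -area f i j k := by
  simp only [area]; ring

theorem inTri_iff (f i j k y : ℕ) : inTri f i j k y = true ↔ 0 < area f i j k * area f i j y ∧
    0 < area f i j k * area f j k y ∧ 0 < area f i j k * area f k i y := by
  simp [inTri, and_assoc]

theorem ptR_mem_hull_of_onSeg {χ : ℕ → Bool} {f i j y : ℕ} (hf : f < 4) (hi : i ∈ face f)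
    (hj : j ∈ face f) (hy : y ∈ face f) (h : onSeg f i j y = true) (hχi : χ i = true)
    (hχj : χ j = true) : ptR y ∈ hull χ := by
  have hi' := (mem_face.1 hi).1
  have hj' := (mem_face.1 hj).1
  have hy' := (mem_face.1 hy).1
  simp only [onSeg, Bool.and_eq_true, decide_eq_true_eq] at h
  obtain ⟨h1, h2⟩ := h
  have h1 : (area f i j y : ℝ) = 0 := by exact_mod_cast h1
  rw [area_cast hi' hj' hy', areaR] at h1
  have h2 := (Int.cast_lt (R := ℝ)).2 h2
  push_cast at h2
  simp only [co_cast, hi', hj', hy'] at h2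
  have b0 := baryR_of_mem_face hf hi
  have b1 := baryR_of_mem_face hf hj
  have b2 := baryR_of_mem_face hf hy
  set u₀ := baryR (ptR i) (Fin.ofNat 4 (f + 1))
  set u₁ := baryR (ptR j) (Fin.ofNat 4 (f + 1))
  set u := baryR (ptR y) (Fin.ofNat 4 (f + 1)) with hu
  set v₀ := baryR (ptR i) (Fin.ofNat 4 (f + 2))
  set v₁ := baryR (ptR j) (Fin.ofNat 4 (f + 2))
  set v := baryR (ptR y) (Fin.ofNat 4 (f + 2)) with hv
  set s := -((u₀ - u) * (u₁ - u) + (v₀ - v) * (v₁ - v)) with hs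
  set t := (u₀ - u) ^ 2 + (v₀ - v) ^ 2 with ht
  have hs0 : 0 < s := by linarith
  have ht0 : 0 ≤ t := by positivity
  have hst : s / (s + t) + t / (s + t) = 1 := by field_simp
  have : ptR y = (s / (s + t)) • ptR i + (t / (s + t)) • ptR j := by
    refine eq_of_baryR_eq f ?_ ?_ ?_ <;> rw [baryR_add hst]
    · rw [b0, b1, b2]; ring
    · have : s + t ≠ 0 := by positivity
      field_simp
      rw [hs, ht]
      linear_combination (v₀ - v) * h1
    · have : s + t ≠ 0 := by positivity
      field_simp
      rw [hs, ht]
      linear_combination (u - u₀) * h1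
  rw [this]
  exact convex_convexHull ℝ _ (ptR_mem_hull hi' hχi) (ptR_mem_hull hj' hχj)
    (by positivity) (by positivity) hst

theorem combination_mem {C : Set (Fin 3 → ℝ)} (hC : Convex ℝ C) {x y z : Fin 3 → ℝ} (hx : x ∈ C)
    (hy : y ∈ C) (hz : z ∈ C) {r s t : ℝ} (hr : 0 ≤ r) (hs : 0 ≤ s) (ht : 0 ≤ t)
    (h : r + s + t = 1) : r • x + s • y + t • z ∈ C := by
  have := hC.sum_mem (t := Finset.univ) (w := ![r, s, t]) (z := ![x, y, z])
    (by intro i _; fin_cases i <;> simpa) (by simpa [Fin.sum_univ_three] using h)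
    (by intro i _; fin_cases i <;> simpa)
  simpa [Fin.sum_univ_three] using this

theorem ptR_mem_hull_of_inTri {χ : ℕ → Bool} {f i j k y : ℕ} (hf : f < 4) (hi : i ∈ face f)
    (hj : j ∈ face f) (hk : k ∈ face f) (hy : y ∈ face f) (h : inTri f i j k y = true)
    (hχi : χ i = true) (hχj : χ j = true) (hχk : χ k = true) : ptR y ∈ hull χ := by
  have hi' := (mem_face.1 hi).1
  have hj' := (mem_face.1 hj).1
  have hk' := (mem_face.1 hk).1
  have hy' := (mem_face.1 hy).1
  obtain ⟨h1, h2, h3⟩ := (inTri_iff _ _ _ _ _).1 h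
  have h1 := (Int.cast_lt (R := ℝ)).2 h1
  have h2 := (Int.cast_lt (R := ℝ)).2 h2
  have h3 := (Int.cast_lt (R := ℝ)).2 h3
  push_cast at h1 h2 h3
  simp only [area_cast, hi', hj', hk', hy'] at h1 h2 h3
  set A := areaR f (ptR i) (ptR j) (ptR k) with hA
  set r := areaR f (ptR j) (ptR k) (ptR y) with hr
  set s := areaR f (ptR k) (ptR i) (ptR y) with hs
  set t := areaR f (ptR i) (ptR j) (ptR y) with ht
  have hA0 : A ≠ 0 := by rintro h0; simp [h0] at h1
  have hd : ∀ {q}, 0 < A * q → 0 ≤ q / A := fun {q} hq => by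
    rw [div_eq_mul_inv, mul_comm, ← div_mul_cancel_left₀ hA0 A]
    rw [div_mul_eq_mul_div]
    exact (div_pos hq (mul_self_pos.2 hA0)).le
  have hsum : r / A + s / A + t / A = 1 := by
    field_simp
    simp only [hA, hr, hs, ht, areaR]
    ring
  have b0 := baryR_of_mem_face hf hi
  have b1 := baryR_of_mem_face hf hj
  have b2 := baryR_of_mem_face hf hk
  have b3 := baryR_of_mem_face hf hy
  have : ptR y = (r / A) • ptR i + (s / A) • ptR j + (t / A) • ptR k := by
    refine eq_of_baryR_eq f ?_ ?_ ?_ <;> rw [baryR_add_add hsum]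
    · rw [b0, b1, b2, b3]; ring
    · field_simp
      simp only [hA, hr, hs, ht, areaR]
      ring
    · field_simp
      simp only [hA, hr, hs, ht, areaR]
      ring
  rw [this]
  exact combination_mem (convex_convexHull ℝ _) (ptR_mem_hull hi' hχi) (ptR_mem_hull hj' hχj)
    (ptR_mem_hull hk' hχk) (hd h2) (hd h3) (hd h1) hsum

theorem areaR_ne_zero {f : ℕ} {z : Fin 3 → Fin 3 → ℝ} (hz : AffineIndependent ℝ z)
    (h0 : ∀ i, baryR (z i) (Fin.ofNat 4 f) = 0) : areaR f (z 0) (z 1) (z 2) ≠ 0 := by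
  intro hA
  rw [areaR] at hA
  have key : ∀ a b : ℝ,
      a * (baryR (z 1) (Fin.ofNat 4 (f + 1)) - baryR (z 0) (Fin.ofNat 4 (f + 1))) +
        b * (baryR (z 2) (Fin.ofNat 4 (f + 1)) - baryR (z 0) (Fin.ofNat 4 (f + 1))) = 0 →
      a * (baryR (z 1) (Fin.ofNat 4 (f + 2)) - baryR (z 0) (Fin.ofNat 4 (f + 2))) +
        b * (baryR (z 2) (Fin.ofNat 4 (f + 2)) - baryR (z 0) (Fin.ofNat 4 (f + 2))) = 0 →
      a = 0 ∧ b = 0 := by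
    intro a b h1 h2
    have hs : (1 - a - b) + a + b = 1 := by ring
    have hz0 : (1 - a - b) • z 0 + a • z 1 + b • z 2 = z 0 := by
      refine eq_of_baryR_eq f ?_ ?_ ?_ <;> rw [baryR_add_add hs]
      · rw [h0, h0, h0]; ring
      · linear_combination h1
      · linear_combination h2
    have := affineIndependent_iff.1 hz Finset.univ ![-a - b, a, b]
      (by simp only [Fin.sum_univ_three, Matrix.cons_val]; ring) (by
        simp only [Fin.sum_univ_three, Matrix.cons_val]
        rw [← sub_eq_zero] at hz0
        rw [← hz0]
        module)
    exact ⟨this 1 (Finset.mem_univ _), this 2 (Finset.mem_univ _)⟩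
  obtain ⟨hu2, hu1⟩ := key
    (baryR (z 2) (Fin.ofNat 4 (f + 1)) - baryR (z 0) (Fin.ofNat 4 (f + 1)))
    (-(baryR (z 1) (Fin.ofNat 4 (f + 1)) - baryR (z 0) (Fin.ofNat 4 (f + 1))))
    (by ring) (by linear_combination -hA)
  obtain ⟨hv2, hv1⟩ := key
    (baryR (z 2) (Fin.ofNat 4 (f + 2)) - baryR (z 0) (Fin.ofNat 4 (f + 2)))
    (-(baryR (z 1) (Fin.ofNat 4 (f + 2)) - baryR (z 0) (Fin.ofNat 4 (f + 2))))
    (by linear_combination hA) (by ring)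
  exact one_ne_zero (key 1 0 (by linear_combination -hu1) (by linear_combination -hv1)).1

theorem onSeg_of_eq {f i j y : ℕ} (hf : f < 4) (hi : i ∈ face f) (hj : j ∈ face f)
    (hy : y < 34) (hij : i ≠ j) {s t : ℝ} (hs : 0 < s) (ht : 0 < t)
    (hst : s + t = 1) (h : s • ptR i + t • ptR j = ptR y) : onSeg f i j y = true := by
  have hi' := (mem_face.1 hi).1
  have hj' := (mem_face.1 hj).1
  have hc := fun c => (congrFun (congrArg baryR h) c).symm.trans (baryR_add hst _ _ c)
  have h1 := hc (Fin.ofNat 4 (f + 1))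
  have h2 := hc (Fin.ofNat 4 (f + 2))
  simp only [onSeg, Bool.and_eq_true, decide_eq_true_eq]
  rw [← Int.cast_lt (R := ℝ), ← Int.cast_inj (α := ℝ), area_cast hi' hj' hy]
  push_cast
  simp only [co_cast, hi', hj', hy, areaR, h1, h2]
  obtain rfl : s = 1 - t := by linarith
  constructor
  · ring
  have hne : ¬(baryR (ptR i) (Fin.ofNat 4 (f + 1)) = baryR (ptR j) (Fin.ofNat 4 (f + 1)) ∧
      baryR (ptR i) (Fin.ofNat 4 (f + 2)) = baryR (ptR j) (Fin.ofNat 4 (f + 2))) := fun ⟨h3, h4⟩ =>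
    hij (ptR_injOn hi' hj' (eq_of_baryR_eq f
      ((baryR_of_mem_face hf hi).trans (baryR_of_mem_face hf hj).symm) h3 h4))
  generalize baryR (ptR i) (Fin.ofNat 4 (f + 1)) = u₀ at *
  generalize baryR (ptR j) (Fin.ofNat 4 (f + 1)) = u₁ at *
  generalize baryR (ptR i) (Fin.ofNat 4 (f + 2)) = v₀ at *
  generalize baryR (ptR j) (Fin.ofNat 4 (f + 2)) = v₁ at *
  have hpos : 0 < (u₀ - u₁) ^ 2 + (v₀ - v₁) ^ 2 := by
    by_contra! hle
    refine hne ⟨?_, ?_⟩ <;> nlinarith [sq_nonneg (u₀ - u₁), sq_nonneg (v₀ - v₁)]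
  nlinarith [mul_pos (mul_pos hs ht) hpos]

theorem inTri_of_eq {f y : ℕ} {v : Fin 3 → ℕ} (hf : f < 4) (hv : ∀ i, v i ∈ face f)
    (hy : y < 34) (hind : AffineIndependent ℝ fun i => ptR (v i)) {w : Fin 3 → ℝ}
    (hw : ∀ i, 0 < w i) (hw1 : w 0 + w 1 + w 2 = 1)
    (h : w 0 • ptR (v 0) + w 1 • ptR (v 1) + w 2 • ptR (v 2) = ptR y) :
    inTri f (v 0) (v 1) (v 2) y = true := by
  have hA := areaR_ne_zero hind fun i => baryR_of_mem_face hf (hv i)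
  have hv' := fun i => (mem_face.1 (hv i)).1
  have hc := fun c => (congrFun (congrArg baryR h) c).symm.trans (baryR_add_add hw1 _ _ _ c)
  have h1 := hc (Fin.ofNat 4 (f + 1))
  have h2 := hc (Fin.ofNat 4 (f + 2))
  rw [inTri_iff]
  simp only [← Int.cast_lt (R := ℝ)]
  push_cast
  simp only [area_cast, hv', hy]
  have h0 : w 0 = 1 - w 1 - w 2 := by linarith
  have e1 : areaR f (ptR (v 0)) (ptR (v 1)) (ptR y) =
      w 2 * areaR f (ptR (v 0)) (ptR (v 1)) (ptR (v 2)) := by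
    simp only [areaR, h1, h2, h0]; ring
  have e2 : areaR f (ptR (v 1)) (ptR (v 2)) (ptR y) =
      w 0 * areaR f (ptR (v 0)) (ptR (v 1)) (ptR (v 2)) := by
    simp only [areaR, h1, h2, h0]; ring
  have e3 : areaR f (ptR (v 2)) (ptR (v 0)) (ptR y) =
      w 1 * areaR f (ptR (v 0)) (ptR (v 1)) (ptR (v 2)) := by
    simp only [areaR, h1, h2, h0]; ring
  rw [e1, e2, e3]
  have hp := mul_self_pos.2 hA
  exact ⟨by nlinarith [mul_pos (hw 2) hp], by nlinarith [mul_pos (hw 0) hp],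
    by nlinarith [mul_pos (hw 1) hp]⟩

theorem card_le_three_of_affineIndependent {ι : Type} [Fintype ι] {z : ι → Fin 3 → ℝ}
    (hz : AffineIndependent ℝ z) {a : Fin 3 → ℝ} {b : ℝ} (ha : a ≠ 0)
    (h : ∀ i, dotp a (z i) = b) : Fintype.card ι ≤ 3 := by
  have h1 := hz.card_le_finrank_succ
  have hle : vectorSpan ℝ (range z) ≤ LinearMap.ker (IsLinearMap.mk' _ (isLinearMap_dotp a)) := by
    rw [vectorSpan, Submodule.span_le]
    rintro _ ⟨_, ⟨i, rfl⟩, _, ⟨j, rfl⟩, rfl⟩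
    change dotp a (z i - z j) = 0
    rw [dotp_sub, h, h, sub_self]
  have hlt : vectorSpan ℝ (range z) < ⊤ := lt_top_iff_ne_top.2 fun ht => by
    have : dotp a a = 0 := hle (ht ▸ Submodule.mem_top)
    exact (dotp_self_pos ha).ne' this
  have h2 := Submodule.finrank_lt hlt.ne
  rw [Module.finrank_fin_fun] at h2
  omega

theorem eq_true_of_ptR_mem_hull {χ : ℕ → Bool} (hseg : ∀ q ∈ famSeg, Avoids q χ)
    (htri : ∀ q ∈ famTri, Avoids q χ) {y : ℕ} (hy : y < 34) (h : ptR y ∈ hull χ) :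
    χ y = true := by
  rw [forall_famSeg] at hseg
  rw [forall_famTri] at htri
  have hface : ∀ y < 34, ∃ f < 4, bary y f = 0 := by decide +kernel
  obtain ⟨f, hf, hyf⟩ := hface y hy
  have hyF : y ∈ face f := mem_face.2 ⟨hy, hyf⟩
  obtain ⟨a, b, hab⟩ := exists_baryR_eq (Fin.ofNat 4 f)
  have ha : a ≠ 0 := by
    rintro rfl
    have h1 := hab pOne
    have h2 := hab (ptR y)
    rw [baryR_pOne] at h1
    rw [baryR_of_mem_face hf hyF] at h2
    simp [dotp] at h1 h2
    linarith
  have hgen : ∀ x ∈ insert pOne {x | ∃ v < 34, χ v = true ∧ x = ptR v}, b ≤ dotp a x := by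
    intro x hx
    rw [← sub_nonneg, ← hab]
    obtain rfl | ⟨v, hv, -, rfl⟩ := hx
    · rw [baryR_pOne]; exact zero_le_one
    · rw [baryR_ptR hv]; positivity
  have hyb : dotp a (ptR y) = b := by
    rw [← sub_eq_zero, ← hab, baryR_of_mem_face hf hyF]
  obtain ⟨ι, _, z, w, hz, hind, hw, hw1, hwz⟩ := exists_pos_combination_on_face hgen h hyb
  have hcard := card_le_three_of_affineIndependent hind ha fun i => (hz i).2
  have hv : ∀ i, ∃ v, v ∈ face f ∧ χ v = true ∧ z i = ptR v := by
    intro i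
    obtain ⟨h1, h2⟩ := hz i
    rw [← sub_eq_zero, ← hab] at h2
    obtain h3 | ⟨v, hv, hχ, h3⟩ := h1
    · rw [h3, baryR_pOne] at h2
      exact absurd h2 one_ne_zero
    · refine ⟨v, mem_face.2 ⟨hv, ?_⟩, hχ, h3⟩
      rw [h3, baryR_ptR hv] at h2
      simpa [Nat.mod_eq_of_lt hf] using h2
  choose v hvf hvχ hzv using hv
  obtain rfl : z = fun i => ptR (v i) := funext hzv
  have hinj : ∀ i j, v i = v j → i = j := fun i j hij =>
    hind.injective (congrArg ptR hij)
  obtain ⟨n, hn⟩ : ∃ n, Fintype.card ι = n := ⟨_, rfl⟩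
  let e := (Fintype.equivFinOfCardEq hn).symm
  rw [← e.sum_comp] at hw1 hwz
  have hind' : AffineIndependent ℝ fun i => ptR (v (e i)) :=
    hind.comp_embedding e.toEmbedding
  rw [hn] at hcard
  clear_value e
  interval_cases n
  · simp at hw1
  · rw [Fin.sum_univ_one] at hw1 hwz
    rw [hw1, one_smul] at hwz
    rw [← ptR_injOn (mem_face.1 (hvf _)).1 hy hwz]
    exact hvχ _
  · rw [Fin.sum_univ_two] at hw1 hwz
    have hne : v (e 0) ≠ v (e 1) := fun h => by simpa using hinj _ _ h
    rcases hne.lt_or_gt with hlt | hlt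
    · exact hseg f hf _ (hvf _) _ (hvf _) hlt y hyF
        (onSeg_of_eq hf (hvf _) (hvf _) hy hlt.ne (hw _) (hw _) hw1 hwz) (hvχ _) (hvχ _)
    · rw [add_comm] at hw1 hwz
      exact hseg f hf _ (hvf _) _ (hvf _) hlt y hyF
        (onSeg_of_eq hf (hvf _) (hvf _) hy hlt.ne (hw _) (hw _) hw1 hwz) (hvχ _) (hvχ _)
  · rw [Fin.sum_univ_three] at hw1 hwz
    have ht := inTri_of_eq (v := fun i => v (e i)) hf (fun i => hvf _) hy hind'
      (fun i => hw (e i)) hw1 hwz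
    let T : ℕ → Prop := fun v => v ∈ face f ∧ χ v = true
    obtain ⟨i, j, k, hij, hjk, ⟨hi, hχi⟩, ⟨hj, hχj⟩, ⟨hk, hχk⟩, ht⟩ :=
      exists_sorted (P := fun i j k => T i ∧ T j ∧ T k ∧ inTri f i j k y = true)
        (fun i j k ⟨hi, hj, hk, ht⟩ => ⟨hj, hi, hk, by
          rw [inTri_iff] at ht ⊢
          rw [area_swap_left f i j k, area_swap_left f i j y, area_swap_left f k i y,
            area_swap_left f j k y]
          simp only [neg_mul_neg]
          exact ⟨ht.1, ht.2.2, ht.2.1⟩⟩)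
        (fun i j k ⟨hi, hj, hk, ht⟩ => ⟨hi, hk, hj, by
          rw [inTri_iff] at ht ⊢
          rw [area_swap_right f i j k, area_swap_left f k i y, area_swap_left f j k y,
            area_swap_left f i j y]
          simp only [neg_mul_neg]
          exact ⟨ht.2.2, ht.2.1, ht.1⟩⟩)
        (fun i j ⟨_, _, _, ht⟩ => by
          have h0 : area f i i j = 0 := by simp [area]
          rw [inTri_iff, h0] at ht
          simp at ht)
        (u := v (e 0)) (v := v (e 1)) (w := v (e 2))
        ⟨⟨hvf _, hvχ _⟩, ⟨hvf _, hvχ _⟩, ⟨hvf _, hvχ _⟩, ht⟩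
    exact htri f hf k hk j hj hjk i hi hij y hyF ht hχi hχj hχk

theorem forall_fam_iff (χ : ℕ → Bool) : (∀ q ∈ fam, Avoids q χ) ↔
    (pOne ∈ interior (hull χ) ∧ IsReflexive (hull χ) pOne) ∧
      ∀ v < 34, ptR v ∈ hull χ → χ v = true := by
  simp only [fam, List.mem_append, or_imp, forall_and]
  rw [famInt_iff]
  constructor
  · rintro ⟨h1, h2, h3, h4⟩
    exact ⟨⟨h1, isReflexive_of_forall_famRef h1 h2⟩, fun v hv => eq_true_of_ptR_mem_hull h3 h4 hv⟩
  · rintro ⟨⟨h1, h2⟩, h3⟩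
    refine ⟨h1, forall_famRef_of_isReflexive h2, (forall_famSeg χ).2 ?_, (forall_famTri χ).2 ?_⟩
    · exact fun f hf j hj i hi _ y hy h hχi hχj =>
        h3 y (mem_face.1 hy).1 (ptR_mem_hull_of_onSeg hf hi hj hy h hχi hχj)
    · exact fun f hf k hk j hj _ i hi _ y hy h hχi hχj hχk =>
        h3 y (mem_face.1 hy).1 (ptR_mem_hull_of_inTri hf hi hj hk hy h hχi hχj hχk)

def vtx : Fin 4 → Fin 3 → ℝ := ![![4, 0, 0], ![0, 4, 0], ![0, 0, 4], ![0, 0, 0]]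

theorem baryR_vtx (c d : Fin 4) : baryR (vtx c) d = if c = d then 4 else 0 := by
  fin_cases c <;> fin_cases d <;> simp [baryR, vtx]

theorem Delta4_eq_convexHull_range : Delta4 = convexHull ℝ (range vtx) := by
  rw [Delta4]
  congr 1
  ext x
  simp only [mem_insert_iff, mem_singleton_iff, mem_range, Fin.exists_fin_succ, vtx]
  simp [eq_comm]
  tauto

theorem mem_Delta4_iff (x : Fin 3 → ℝ) : x ∈ Delta4 ↔ ∀ c, 0 ≤ baryR x c := by
  rw [Delta4_eq_convexHull_range]
  constructor
  · intro hx c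
    obtain ⟨a, b, hab⟩ := exists_baryR_eq c
    rw [hab, sub_nonneg]
    refine le_dotp_of_mem_convexHull ?_ x hx
    rintro _ ⟨d, rfl⟩
    rw [← sub_nonneg, ← hab, baryR_vtx]
    split_ifs <;> norm_num
  · intro h
    have hx : x = ∑ c, (baryR x c / 4) • vtx c := by
      ext i
      fin_cases i <;> simp [Fin.sum_univ_four, vtx, baryR]
    rw [hx]
    refine (convex_convexHull ℝ _).sum_mem (fun c _ => div_nonneg (h c) (by norm_num)) ?_
      fun c _ => subset_convexHull ℝ _ (mem_range_self c)
    simp [Fin.sum_univ_four, baryR]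
    ring

theorem pOne_mem_Delta4 : pOne ∈ Delta4 ∩ latticePts :=
  ⟨(mem_Delta4_iff _).2 fun c => (baryR_pOne c).symm ▸ zero_le_one,
    fun i => ⟨1, by fin_cases i <;> simp [pOne]⟩⟩

theorem ptR_mem_Delta4 {v : ℕ} (hv : v < 34) : ptR v ∈ Delta4 ∩ latticePts :=
  ⟨(mem_Delta4_iff _).2 fun c => by rw [baryR_ptR hv]; positivity,
    fun i => ⟨![(pt v).1, (pt v).2.1, (pt v).2.2] i, by fin_cases i <;> simp [ptR, toR]⟩⟩

theorem eq_pOne_or_ptR {x : Fin 3 → ℝ} (hx : x ∈ Delta4 ∩ latticePts) :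
    x = pOne ∨ ∃ v < 34, x = ptR v := by
  obtain ⟨h, hl⟩ := hx
  rw [mem_Delta4_iff] at h
  choose n hn using hl
  have hnat : ∀ i, ∃ m : ℕ, x i = m := fun i => by
    have h0 : 0 ≤ x i := by
      have := h i.castSucc
      fin_cases i <;> simpa [baryR] using this
    rw [hn i] at h0
    have h0 : 0 ≤ n i := by exact_mod_cast h0
    exact ⟨(n i).toNat, by rw [hn i]; exact_mod_cast (Int.toNat_of_nonneg h0).symm⟩
  choose m hm using hnat
  have h3 : m 0 + m 1 + m 2 ≤ 4 := by
    have := h 3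
    simp only [baryR, Matrix.cons_val, hm] at this
    have : (m 0 + m 1 + m 2 : ℝ) ≤ 4 := by linarith
    exact_mod_cast this
  have key : ∀ a b c : Fin 5, a.val + b + c ≤ 4 → ¬(a.val = 1 ∧ b.val = 1 ∧ c.val = 1) →
      ∃ v < 34, (bary v 0, bary v 1, bary v 2) = (a.val, b.val, c.val) := by decide +kernel
  by_cases h1 : m 0 = 1 ∧ m 1 = 1 ∧ m 2 = 1
  · exact .inl (funext fun i => by fin_cases i <;> simp [hm, h1, pOne])
  obtain ⟨v, hv, h⟩ := key ⟨m 0, by omega⟩ ⟨m 1, by omega⟩ ⟨m 2, by omega⟩ h3 h1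
  simp only [Prod.mk.injEq] at h
  exact .inr ⟨v, hv, funext fun i => by fin_cases i <;> simp [hm, ← h, ptR, toR, pt]⟩

theorem isCanonicalSub_hull_iff (χ : ℕ → Bool) :
    IsCanonicalSub (hull χ) ↔ pOne ∈ interior (hull χ) := by
  refine ⟨And.right, fun h => ⟨⟨?_, ?_⟩, h⟩⟩
  · refine convexHull_min ?_ (convex_convexHull ℝ _)
    rintro x (rfl | ⟨v, hv, -, rfl⟩)
    · exact pOne_mem_Delta4.1
    · exact (ptR_mem_Delta4 hv).1
  · refine (convexHull_min ?_ (convex_convexHull ℝ _)).antisymm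
      (convexHull_min inter_subset_left (convex_convexHull ℝ _))
    rintro x (rfl | ⟨v, hv, hχ, rfl⟩)
    · exact subset_convexHull ℝ _ ⟨pOne_mem_hull χ, pOne_mem_Delta4.2⟩
    · exact subset_convexHull ℝ _ ⟨ptR_mem_hull hv hχ, (ptR_mem_Delta4 hv).2⟩

open Classical in
/-- The indicator list of the boundary lattice points of `4Δ₃` contained in `P`. -/
def code (P : Set (Fin 3 → ℝ)) : List Bool := (List.range 34).map fun v => decide (ptR v ∈ P)

theorem length_code (P : Set (Fin 3 → ℝ)) : (code P).length = 34 := by simp [code]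

theorem getD_code (P : Set (Fin 3 → ℝ)) {v : ℕ} (hv : v < 34) :
    (code P).getD v false = true ↔ ptR v ∈ P := by
  simp [code, List.getD_eq_getElem?_getD, List.getElem?_map, List.getElem?_range hv]

theorem eq_hull_of_isCanonicalSub {P : Set (Fin 3 → ℝ)} (h : IsCanonicalSub P) :
    P = hull fun v => (code P).getD v false := by
  conv_lhs => rw [h.1.2]
  rw [hull]
  congr 1
  ext x
  constructor
  · rintro ⟨hx, hl⟩
    obtain rfl | ⟨v, hv, rfl⟩ := eq_pOne_or_ptR ⟨h.1.1 hx, hl⟩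
    · exact mem_insert _ _
    · exact mem_insert_of_mem _ ⟨v, hv, (getD_code P hv).2 hx, rfl⟩
  · rintro (rfl | ⟨v, hv, hχ, rfl⟩)
    · exact ⟨interior_subset h.2, pOne_mem_Delta4.2⟩
    · exact ⟨(getD_code P hv).1 hχ, (ptR_mem_Delta4 hv).2⟩

/-- The reflexive canonical subpolytopes of `4Δ₃`. -/
def reflexives : Set (Set (Fin 3 → ℝ)) := {P | IsCanonicalSub P ∧ IsReflexive P pOne}

theorem injOn_code : InjOn code reflexives := by
  intro P hP Q hQ h
  rw [eq_hull_of_isCanonicalSub hP.1, eq_hull_of_isCanonicalSub hQ.1, h]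

theorem avoids_code {P : Set (Fin 3 → ℝ)} (hP : P ∈ reflexives) :
    ∀ q ∈ fam, Avoids q fun v => (code P).getD v false := by
  rw [forall_fam_iff, ← eq_hull_of_isCanonicalSub hP.1]
  exact ⟨⟨hP.1.2, hP.2⟩, fun v hv => (getD_code P hv).2⟩

theorem exists_code_eq {b : List Bool} (hb : b.length = 34)
    (h : ∀ q ∈ fam, Avoids q fun v => b.getD v false) : ∃ P ∈ reflexives, code P = b := by
  rw [forall_fam_iff] at h
  refine ⟨_, ⟨(isCanonicalSub_hull_iff _).2 h.1.1, h.1.2⟩, ?_⟩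
  refine List.ext_getElem ((length_code _).trans hb.symm) fun v hv hv' => ?_
  rw [length_code] at hv
  have h1 := getD_code (hull fun v => b.getD v false) hv
  rw [List.getD_eq_getElem _ _ (by rwa [length_code])] at h1
  rw [Bool.eq_iff_iff, h1]
  constructor
  · intro h2
    have h3 : b.getD v false = true := h.2 v hv h2
    rwa [List.getD_eq_getElem _ _ hv'] at h3
  · intro h2
    exact ptR_mem_hull hv (by rwa [List.getD_eq_getElem _ _ hv'])

def bcoef : Fin 4 → Fin 3 → ℤ := ![![1, 0, 0], ![0, 1, 0], ![0, 0, 1], ![-1, -1, -1]]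

def bconst : Fin 4 → ℤ := ![0, 0, 0, 4]

theorem baryR_eq (x : Fin 3 → ℝ) (c : Fin 4) :
    baryR x c = dotp (fun i => (bcoef c i : ℝ)) x + bconst c := by
  fin_cases c <;> simp [baryR, bcoef, bconst, dotp_three]
  ring

theorem sum_baryR (x : Fin 3 → ℝ) : ∑ c, baryR x c = 4 := by
  simp [Fin.sum_univ_four, baryR]

theorem baryR_injective : Function.Injective baryR := fun x y h => by
  ext i
  have := congrFun h i.castSucc
  fin_cases i <;> simpa [baryR] using this

/-- The affine map permuting the barycentric coordinates by `σ`. -/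
def actMap (σ : Equiv.Perm (Fin 4)) : (Fin 3 → ℝ) →ᵃ[ℝ] (Fin 3 → ℝ) where
  toFun x i := baryR x (σ⁻¹ i.castSucc)
  linear := LinearMap.pi fun i => IsLinearMap.mk' _
    (isLinearMap_dotp fun j => (bcoef (σ⁻¹ i.castSucc) j : ℝ))
  map_vadd' x v := by
    ext i
    simp [baryR_eq, (isLinearMap_dotp _).map_add, add_assoc]

theorem baryR_actMap (σ : Equiv.Perm (Fin 4)) (x : Fin 3 → ℝ) (c : Fin 4) :
    baryR (actMap σ x) c = baryR x (σ⁻¹ c) := by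
  have h : ∀ i : Fin 3, baryR (actMap σ x) i.castSucc = baryR x (σ⁻¹ i.castSucc) := fun i => by
    change baryR _ _ = actMap σ x i
    fin_cases i <;> rfl
  obtain ⟨i, rfl⟩ | rfl := c.eq_castSucc_or_eq_last
  · exact h i
  · have h1 := sum_baryR (actMap σ x)
    have h2 := (Equiv.sum_comp σ⁻¹ (baryR x)).trans (sum_baryR x)
    rw [Fin.sum_univ_castSucc] at h1 h2
    simp only [h] at h1
    linarith

theorem actMap_mul (σ τ : Equiv.Perm (Fin 4)) (x : Fin 3 → ℝ) :
    actMap (σ * τ) x = actMap σ (actMap τ x) :=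
  baryR_injective (funext fun c => by simp [baryR_actMap])

theorem actMap_one (x : Fin 3 → ℝ) : actMap 1 x = x :=
  baryR_injective (funext fun c => by simp [baryR_actMap])

/-- The symmetry of `4Δ₃` permuting the vertices by `σ`. -/
def act (σ : Equiv.Perm (Fin 4)) : (Fin 3 → ℝ) ≃ᵃ[ℝ] (Fin 3 → ℝ) :=
  AffineEquiv.ofBijective (φ := actMap σ)
    ⟨fun x y h => by rw [← actMap_one x, ← actMap_one y, ← inv_mul_cancel σ, actMap_mul, h,
        actMap_mul],
      fun x => ⟨actMap σ⁻¹ x, by rw [← actMap_mul, mul_inv_cancel, actMap_one]⟩⟩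

theorem baryR_act (σ : Equiv.Perm (Fin 4)) (x : Fin 3 → ℝ) (c : Fin 4) :
    baryR (act σ x) c = baryR x (σ⁻¹ c) :=
  baryR_actMap σ x c

theorem act_mul (σ τ : Equiv.Perm (Fin 4)) (x : Fin 3 → ℝ) : act (σ * τ) x = act σ (act τ x) :=
  actMap_mul σ τ x

theorem act_one (x : Fin 3 → ℝ) : act 1 x = x := actMap_one x

theorem act_inv_act (σ : Equiv.Perm (Fin 4)) (x : Fin 3 → ℝ) : act σ⁻¹ (act σ x) = x := by
  rw [← act_mul, inv_mul_cancel, act_one]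

theorem act_act_inv (σ : Equiv.Perm (Fin 4)) (x : Fin 3 → ℝ) : act σ (act σ⁻¹ x) = x := by
  rw [← act_mul, mul_inv_cancel, act_one]

theorem mem_image_act {σ : Equiv.Perm (Fin 4)} {S : Set (Fin 3 → ℝ)} {x : Fin 3 → ℝ} :
    x ∈ act σ '' S ↔ act σ⁻¹ x ∈ S :=
  ⟨by rintro ⟨y, hy, rfl⟩; rwa [act_inv_act], fun h => ⟨_, h, act_act_inv σ x⟩⟩

theorem act_mem_Delta4 (σ : Equiv.Perm (Fin 4)) {x : Fin 3 → ℝ} (hx : x ∈ Delta4) :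
    act σ x ∈ Delta4 := by
  rw [mem_Delta4_iff] at hx ⊢
  exact fun c => baryR_act σ x c ▸ hx _

theorem image_act_Delta4 (σ : Equiv.Perm (Fin 4)) : act σ '' Delta4 = Delta4 :=
  (image_subset_iff.2 fun _ => act_mem_Delta4 σ).antisymm
    fun _ hx => mem_image_act.2 (act_mem_Delta4 _ hx)

theorem act_mem_latticePts (σ : Equiv.Perm (Fin 4)) {x : Fin 3 → ℝ} (hx : x ∈ latticePts) :
    act σ x ∈ latticePts := fun i => by
  choose n hn using hx
  refine ⟨∑ j, bcoef (σ⁻¹ i.castSucc) j * n j + bconst (σ⁻¹ i.castSucc), ?_⟩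
  change baryR x (σ⁻¹ i.castSucc) = _
  rw [baryR_eq, dotp]
  push_cast
  simp only [hn]

theorem act_pOne (σ : Equiv.Perm (Fin 4)) : act σ pOne = pOne :=
  baryR_injective (funext fun c => by rw [baryR_act, baryR_pOne, baryR_pOne])

theorem dotp_act (σ : Equiv.Perm (Fin 4)) (a x : Fin 3 → ℝ) :
    dotp a (act σ x) = dotp (fun j => ∑ i, a i * bcoef (σ⁻¹ i.castSucc) j) x +
      ∑ i, a i * bconst (σ⁻¹ i.castSucc) := by
  have h : ∀ i, act σ x i = baryR x (σ⁻¹ i.castSucc) := fun _ => rfl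
  conv_lhs => simp only [dotp, h, baryR_eq, mul_add, Finset.sum_add_distrib]
  congr 1
  simp only [dotp, Finset.mul_sum, Finset.sum_mul]
  rw [Finset.sum_comm]
  simp only [mul_assoc]

theorem isFacetOf_image_act (σ : Equiv.Perm (Fin 4)) {F P : Set (Fin 3 → ℝ)}
    (h : IsFacetOf F (act σ '' P)) : IsFacetOf (act σ⁻¹ '' F) P := by
  obtain ⟨a, b, h1, rfl, h3⟩ := h
  refine ⟨fun j => ∑ i, a i * bcoef (σ⁻¹ i.castSucc) j,
    b - ∑ i, a i * bconst (σ⁻¹ i.castSucc), fun x hx => ?_, ?_, ?_⟩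
  · have := h1 _ (mem_image_of_mem _ hx)
    rw [dotp_act] at this
    linarith
  · ext x
    rw [mem_image_act, inv_inv, mem_inter_iff, mem_image_act, act_inv_act, mem_inter_iff]
    simp only [mem_ofPred_eq]
    rw [dotp_act, eq_sub_iff_add_eq]
  · rw [← h3]
    have := AffineSubspace.map_span (act σ⁻¹).toAffineMap
      (act σ '' P ∩ {x | dotp a x = b})
    rw [AffineEquiv.coe_toAffineMap] at this
    rw [← this, AffineSubspace.map_direction]
    exact LinearEquiv.finrank_map_eq (act σ⁻¹).linear _

theorem image_act_mem_reflexives (σ : Equiv.Perm (Fin 4)) {P : Set (Fin 3 → ℝ)}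
    (h : P ∈ reflexives) : act σ '' P ∈ reflexives := by
  obtain ⟨⟨⟨h1, h2⟩, h3⟩, h4⟩ := h
  refine ⟨⟨⟨?_, ?_⟩, ?_⟩, ?_⟩
  · exact image_subset_iff.2 fun x hx => act_mem_Delta4 σ (h1 hx)
  · conv_lhs => rw [h2]
    rw [← AffineEquiv.coe_toAffineMap, AffineMap.image_convexHull, AffineEquiv.coe_toAffineMap]
    congr 1
    ext x
    simp only [mem_inter_iff, mem_image_act]
    exact and_congr_right fun _ =>
      ⟨fun h => act_act_inv σ x ▸ act_mem_latticePts σ h, fun h => act_mem_latticePts _ h⟩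
  · have : act σ '' interior P = interior (act σ '' P) :=
      (AffineEquiv.toContinuousAffineEquiv (act σ)).toHomeomorph.image_interior P
    exact this ▸ ⟨pOne, h3, act_pOne σ⟩
  · intro F hF
    obtain ⟨a, b, h5, h6, h7⟩ := h4 _ (isFacetOf_image_act σ hF)
    have key : ∀ x, dotp (fun j => ((∑ i, a i * bcoef (σ⁻¹⁻¹ i.castSucc) j : ℤ) : ℝ)) x =
        dotp (fun i => (a i : ℝ)) (act σ⁻¹ x) -
          (∑ i, a i * bconst (σ⁻¹⁻¹ i.castSucc) : ℤ) := fun x => by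
      rw [dotp_act]
      push_cast
      ring
    refine ⟨fun j => ∑ i, a i * bcoef (σ⁻¹⁻¹ i.castSucc) j,
      b - ∑ i, a i * bconst (σ⁻¹⁻¹ i.castSucc), fun x hx => ?_, fun x hx => ?_, ?_⟩
    · rw [key, h5 _ (mem_image_of_mem _ hx), Int.cast_sub]
    · rw [key, Int.cast_sub]
      exact sub_le_sub_right (h6 _ (mem_image_act.1 hx)) _
    · rw [key, act_pOne, h7, Int.cast_sub]
      ring

instance : MulAction (Equiv.Perm (Fin 4)) reflexives where
  smul σ P := ⟨act σ '' P, image_act_mem_reflexives σ P.2⟩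
  one_smul P := Subtype.ext <| by
    change act 1 '' (P : Set (Fin 3 → ℝ)) = P
    simp [act_one]
  mul_smul σ τ P := Subtype.ext <| by
    change act (σ * τ) '' (P : Set (Fin 3 → ℝ)) = act σ '' (act τ '' P)
    rw [image_image]
    simp only [act_mul]

theorem coe_smul (σ : Equiv.Perm (Fin 4)) (P : reflexives) :
    ((σ • P : reflexives) : Set (Fin 3 → ℝ)) = act σ '' P := rfl

theorem map_eq_sum_vtx (f : (Fin 3 → ℝ) →ᵃ[ℝ] (Fin 3 → ℝ)) (x : Fin 3 → ℝ) :
    f x = ∑ c, (baryR x c / 4) • f (vtx c) := by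
  have h1 : ∑ c, baryR x c / 4 = 1 := by
    rw [← Finset.sum_div, sum_baryR]; norm_num
  have hx : x = ∑ c, (baryR x c / 4) • vtx c := by
    ext i
    fin_cases i <;> simp [Fin.sum_univ_four, vtx, baryR]
  conv_lhs => rw [hx, ← Finset.affineCombination_eq_linear_combination _ _ _ h1,
    Finset.map_affineCombination _ _ _ h1, Finset.affineCombination_eq_linear_combination _ _ _ h1]
  rfl

theorem vtx_mem_Delta4 (c : Fin 4) : vtx c ∈ Delta4 := by
  rw [Delta4_eq_convexHull_range]
  exact subset_convexHull ℝ _ (mem_range_self c)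

theorem act_vtx (σ : Equiv.Perm (Fin 4)) (c : Fin 4) : act σ (vtx c) = vtx (σ c) :=
  baryR_injective (funext fun d => by
    rw [baryR_act, baryR_vtx, baryR_vtx]
    simp only [Equiv.Perm.eq_inv_iff_eq])

theorem eq_vtx_of_baryR_eq_four {x : Fin 3 → ℝ} (hx : x ∈ Delta4) {c : Fin 4}
    (h : baryR x c = 4) : x = vtx c := by
  rw [mem_Delta4_iff] at hx
  have hs := sum_baryR x
  rw [← Finset.add_sum_erase _ _ (Finset.mem_univ c), h, add_eq_left,
    Finset.sum_eq_zero_iff_of_nonneg fun d _ => hx d] at hs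
  refine baryR_injective (funext fun d => ?_)
  rw [baryR_vtx]
  split_ifs with hcd
  · rw [← hcd, h]
  · exact hs d (Finset.mem_erase.2 ⟨Ne.symm hcd, Finset.mem_univ d⟩)

theorem exists_eq_act {g : (Fin 3 → ℝ) ≃ᵃ[ℝ] (Fin 3 → ℝ)} (hg : g '' Delta4 = Delta4) :
    ∃ σ, ∀ x, g x = act σ x := by
  have hgD : ∀ x ∈ Delta4, g x ∈ Delta4 := fun x hx => hg ▸ mem_image_of_mem g hx
  have hvtx : ∀ c, ∃ d, g (vtx d) = vtx c := by
    intro c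
    by_contra! hne
    have hlt : ∀ d, baryR (g (vtx d)) c < 4 := fun d => by
      refine lt_of_le_of_ne ?_ fun h =>
        hne d (eq_vtx_of_baryR_eq_four (hgD _ (vtx_mem_Delta4 d)) h)
      rw [← sum_baryR (g (vtx d))]
      exact Finset.single_le_sum (f := baryR (g (vtx d)))
        (fun e _ => (mem_Delta4_iff _).1 (hgD _ (vtx_mem_Delta4 d)) e) (Finset.mem_univ c)
    obtain ⟨a, b, hab⟩ := exists_baryR_eq c
    have hsub : g '' Delta4 ⊆ {x | dotp a x < 4 + b} := by
      rw [Delta4_eq_convexHull_range, ← AffineEquiv.coe_toAffineMap, AffineMap.image_convexHull]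
      refine convexHull_min ?_ (convex_halfSpace_lt (isLinearMap_dotp a) _)
      rintro _ ⟨_, ⟨d, rfl⟩, rfl⟩
      exact sub_lt_iff_lt_add.1 (hab _ ▸ hlt d)
    have h4 := hsub (hg.symm ▸ vtx_mem_Delta4 c)
    rw [mem_ofPred_eq, ← sub_lt_iff_lt_add, ← hab, baryR_vtx, if_pos rfl] at h4
    exact h4.false
  choose τ hτ using hvtx
  have hτi : Function.Injective τ := fun c d h => by
    have h1 : vtx c = vtx d := (hτ c).symm.trans ((congrArg (fun e => g (vtx e)) h).trans (hτ d))
    have h2 := congrFun (congrArg baryR h1) c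
    rw [baryR_vtx, baryR_vtx, if_pos rfl] at h2
    by_contra hcd
    rw [if_neg (Ne.symm hcd)] at h2
    norm_num at h2
  let σ := Equiv.ofBijective τ (Finite.injective_iff_bijective.1 hτi)
  refine ⟨σ⁻¹, fun x => ?_⟩
  have h1 := map_eq_sum_vtx g.toAffineMap x
  have h2 := map_eq_sum_vtx (act σ⁻¹).toAffineMap x
  simp only [AffineEquiv.coe_toAffineMap] at h1 h2
  rw [h1, h2]
  refine Finset.sum_congr rfl fun c _ => ?_
  obtain ⟨d, rfl⟩ := σ.surjective c
  rw [act_vtx, show σ⁻¹ (σ d) = d from σ.symm_apply_apply d]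
  exact congrArg _ (hτ d)

theorem symEquiv_iff (P Q : reflexives) :
    SymEquiv P Q ↔ P ∈ MulAction.orbit (Equiv.Perm (Fin 4)) Q := by
  rw [← MulAction.orbitRel_apply, MulAction.orbitRel_apply, MulAction.mem_orbit_symm,
    MulAction.mem_orbit_iff]
  constructor
  · rintro ⟨g, hg, h⟩
    obtain ⟨σ, hσ⟩ := exists_eq_act hg
    exact ⟨σ, Subtype.ext (by rw [coe_smul, ← h]; exact image_congr fun x _ => (hσ x).symm)⟩
  · rintro ⟨σ, rfl⟩
    exact ⟨act σ, image_act_Delta4 σ, rfl⟩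

/-- The values of `σ⁻¹`. -/
def values (σ : Equiv.Perm (Fin 4)) : List ℕ :=
  (List.range 4).map fun c => (σ⁻¹ (Fin.ofNat 4 c)).val

theorem getD_values (σ : Equiv.Perm (Fin 4)) {c : ℕ} (hc : c < 4) :
    (values σ).getD c 0 = σ⁻¹ (Fin.ofNat 4 c) := by
  simp [values, List.getD_eq_getElem?_getD, List.getElem?_map, List.getElem?_range hc]

theorem ptR_idx (σ : Equiv.Perm (Fin 4)) {v : ℕ} (hv : v < 34) :
    ptR (idx (values σ) v) = act σ (ptR v) := by
  have hb : ∀ c < 4, baryR (act σ (ptR v)) (Fin.ofNat 4 c) = bary v ((values σ).getD c 0) :=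
    fun c hc => by rw [baryR_act, baryR_ptR hv, getD_values σ hc]
  have hmem : act σ (ptR v) ∈ Delta4 ∩ latticePts :=
    ⟨act_mem_Delta4 σ (ptR_mem_Delta4 hv).1, act_mem_latticePts σ (ptR_mem_Delta4 hv).2⟩
  have hex : ∃ u < 34, ∀ c < 4, bary u c = bary v ((values σ).getD c 0) := by
    obtain h | ⟨u, hu, h⟩ := eq_pOne_or_ptR hmem
    · have h1 : ∀ v < 34, ¬ (bary v 0 = 1 ∧ bary v 1 = 1 ∧ bary v 2 = 1 ∧ bary v 3 = 1) := by
        decide +kernel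
      have h2 : ∀ c : Fin 4, bary v c = 1 := fun c => by
        have := baryR_act σ (ptR v) (σ c)
        rw [h, baryR_pOne, show σ⁻¹ (σ c) = c from σ.symm_apply_apply c, baryR_ptR hv] at this
        exact_mod_cast this.symm
      exact absurd ⟨h2 0, h2 1, h2 2, h2 3⟩ (h1 v hv)
    · refine ⟨u, hu, fun c hc => ?_⟩
      have := hb c hc
      rw [h, baryR_ptR hu, Fin.val_ofNat, Nat.mod_eq_of_lt hc] at this
      exact_mod_cast this
  have hidx : ∀ c < 4, bary (idx (values σ) v) c = bary v ((values σ).getD c 0) := by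
    unfold idx
    rcases h : List.find? _ (List.range 34) with _ | u
    · obtain ⟨u, hu, h'⟩ := hex
      have := List.find?_eq_none.1 h u (List.mem_range.2 hu)
      simp only [List.all_eq_true, List.mem_range, Nat.beq_eq] at this
      exact absurd h' this
    · have := List.find?_some h
      simpa only [List.all_eq_true, List.mem_range, Nat.beq_eq, Option.getD_some] using this
  refine baryR_injective (funext fun c => ?_)
  have hc := hb c c.2
  rw [Fin.ofNat_val_eq_self] at hc
  rw [hc, baryR_ptR (idx_lt _ _), hidx c c.2]

theorem image_act_eq_iff (σ : Equiv.Perm (Fin 4)) {P : Set (Fin 3 → ℝ)} :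
    act σ '' P = P ↔ ∀ x ∈ P, act σ x ∈ P := by
  refine ⟨fun h x hx => h ▸ mem_image_of_mem _ hx, fun h => ?_⟩
  refine (image_subset_iff.2 h).antisymm fun x hx => mem_image_act.2 ?_
  obtain ⟨n, hn⟩ := mem_powers_iff_mem_zpowers.2 (inv_mem (Subgroup.mem_zpowers σ))
  have hpow : ∀ n : ℕ, act (σ ^ n) x ∈ P := fun n => by
    induction n with
    | zero => rwa [pow_zero, act_one]
    | succ n ih => rw [pow_succ', act_mul]; exact h _ ih
  exact hn ▸ hpow n

theorem smul_eq_iff (σ : Equiv.Perm (Fin 4)) (P : reflexives) : σ • P = P ↔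
    ∀ v < 34, (code P).getD v false = true → (code P).getD (idx (values σ) v) false = true := by
  rw [Subtype.ext_iff, coe_smul, image_act_eq_iff]
  constructor
  · intro h v hv hP
    rw [getD_code _ hv] at hP
    rw [getD_code _ (idx_lt _ _), ptR_idx σ hv]
    exact h _ hP
  · intro h x hx
    obtain ⟨⟨⟨hP, hP'⟩, hp⟩, -⟩ := P.2
    have hsub : (P : Set (Fin 3 → ℝ)) ∩ latticePts ⊆ act σ ⁻¹' P := by
      rintro y ⟨hy, hy'⟩
      obtain rfl | ⟨v, hv, rfl⟩ := eq_pOne_or_ptR ⟨hP hy, hy'⟩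
      · rwa [mem_preimage, act_pOne]
      · have := h v hv ((getD_code _ hv).2 hy)
        rwa [getD_code _ (idx_lt _ _), ptR_idx σ hv] at this
    have hconv : Convex ℝ (P : Set (Fin 3 → ℝ)) := hP' ▸ convex_convexHull ℝ _
    rw [hP'] at hx
    exact convexHull_min hsub (hconv.affine_preimage (act σ).toAffineMap) hx

theorem ncard_eq_length {S : Set reflexives} {L : List (List Bool)} (hL : L.Nodup)
    (h : ∀ b, b ∈ L ↔ ∃ P ∈ S, code P = b) : S.ncard = L.length := by
  have himg : (fun P : reflexives => code P) '' S = L.toFinset := by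
    ext b
    simp [h]
  rw [← ncard_image_of_injective S (injOn_iff_injective.1 injOn_code),
    ← List.toFinset_card_of_nodup hL,
    ← ncard_coe_finset]
  exact congrArg _ himg

theorem ncard_univ_reflexives : (univ : Set reflexives).ncard = 349959 := by
  rw [ncard_eq_length (nodup_sols rows (2 ^ 2046 - 1)), length_sols_rows]
  intro b
  rw [mem_sols_rows]
  constructor
  · rintro ⟨hb, h⟩
    obtain ⟨P, hP, rfl⟩ := exists_code_eq hb h
    exact ⟨⟨P, hP⟩, mem_univ _, rfl⟩
  · rintro ⟨P, -, rfl⟩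
    exact ⟨length_code _, avoids_code P.2⟩

theorem ncard_fixedBy (σ : Equiv.Perm (Fin 4)) :
    (MulAction.fixedBy reflexives σ).ncard = count (symRows (values σ)) (2 ^ 2080 - 1) := by
  rw [count_eq_length_sols]
  refine ncard_eq_length (nodup_sols _ _) fun b => ?_
  rw [mem_sols_symRows]
  constructor
  · rintro ⟨hb, h, hs⟩
    obtain ⟨P, hP, rfl⟩ := exists_code_eq hb h
    exact ⟨⟨P, hP⟩, (smul_eq_iff σ ⟨P, hP⟩).2 hs, rfl⟩
  · rintro ⟨P, hP, rfl⟩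
    exact ⟨length_code _, avoids_code P.2, (smul_eq_iff σ P).1 hP⟩

theorem sum_ncard_fixedBy :
    ∑ σ : Equiv.Perm (Fin 4), (MulAction.fixedBy reflexives σ).ncard = 363336 := by
  obtain ⟨f, hf⟩ : ∃ f : List ℕ → ℕ, ∀ s, f s = count (symRows s) (2 ^ 2080 - 1) :=
    ⟨_, fun _ => rfl⟩
  have h1 : f (values 1) = 349959 := by
    rw [hf, ← ncard_fixedBy, MulAction.fixedBy_one_eq_univ, ncard_univ_reflexives]
  have h2 : (nontrivialPerms.map f).sum = 13377 := by
    rw [← sum_count_symRows]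
    exact congrArg List.sum (List.map_congr_left fun s _ => hf s)
  have h3 : values 1 = [0, 1, 2, 3] := by decide +kernel
  have h4 : ((Finset.univ : Finset (Equiv.Perm (Fin 4))).val.map values) =
      ↑([0, 1, 2, 3] :: nontrivialPerms) := perm_values
  calc ∑ σ : Equiv.Perm (Fin 4), (MulAction.fixedBy reflexives σ).ncard
      = ∑ σ : Equiv.Perm (Fin 4), f (values σ) :=
        Finset.sum_congr rfl fun σ _ => by rw [ncard_fixedBy, hf]
    _ = (((Finset.univ : Finset (Equiv.Perm (Fin 4))).val.map values).map f).sum := by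
        rw [Multiset.map_map]; rfl
    _ = 363336 := by
        rw [h4, Multiset.map_coe, Multiset.sum_coe, List.map_cons, List.sum_cons, h2, ← h3, h1]

instance : Finite reflexives :=
  finite_univ_iff.1 (finite_of_ncard_ne_zero (by rw [ncard_univ_reflexives]; norm_num))

theorem card_orbits :
    Nat.card (MulAction.orbitRel.Quotient (Equiv.Perm (Fin 4)) reflexives) = 15139 := by
  classical
  have := Fintype.ofFinite (MulAction.orbitRel.Quotient (Equiv.Perm (Fin 4)) reflexives)
  have (σ : Equiv.Perm (Fin 4)) := Fintype.ofFinite (MulAction.fixedBy reflexives σ)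
  have h := MulAction.sum_card_fixedBy_eq_card_orbits_mul_card_group (Equiv.Perm (Fin 4)) reflexives
  simp only [← Nat.card_eq_fintype_card, Nat.card_coe_set_eq, sum_ncard_fixedBy, Nat.card_perm,
    Nat.card_fin] at h
  change Nat.card (Quotient (MulAction.orbitRel (Equiv.Perm (Fin 4)) reflexives)) = 15139
  rw [show Nat.factorial 4 = 24 from rfl] at h
  omega

theorem exists_representatives : ∃ R : Set (Set (Fin 3 → ℝ)), R.Finite ∧ R.ncard = 15139 ∧
    (∀ P ∈ R, P ∈ reflexives) ∧ ∀ P ∈ reflexives, ∃! Q, Q ∈ R ∧ SymEquiv P Q := by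
  let out (q : MulAction.orbitRel.Quotient (Equiv.Perm (Fin 4)) reflexives) :
      Set (Fin 3 → ℝ) := q.out
  have hout : Function.Injective out :=
    Subtype.val_injective.comp (Function.LeftInverse.injective Quotient.out_eq)
  refine ⟨range out, finite_range _, ?_, ?_, fun P hP => ?_⟩
  · rw [← image_univ, ncard_image_of_injective _ hout, ncard_univ, card_orbits]
  · rintro _ ⟨q, rfl⟩
    exact q.out.2
  · have key (q) : SymEquiv P (out q) ↔ Quotient.mk'' ⟨P, hP⟩ = q := by
      rw [symEquiv_iff ⟨P, hP⟩ q.out, ← MulAction.orbitRel_apply, ← Quotient.eq'', Quotient.out_eq']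
    refine ⟨_, ⟨mem_range_self _, (key _).2 rfl⟩, ?_⟩
    rintro _ ⟨⟨q, rfl⟩, h⟩
    rw [(key q).1 h]

end Quartic

theorem stmt1 :
    ∃ R : Set (Set (Fin 3 → ℝ)), R.Finite ∧ R.ncard = 15139 ∧
      (∀ P ∈ R, IsCanonicalSub P ∧ IsReflexive P pOne) ∧
      ∀ P, IsCanonicalSub P → IsReflexive P pOne → ∃! Q, Q ∈ R ∧ SymEquiv P Q := by
  obtain ⟨R, hfin, hcard, hR, huniq⟩ := Quartic.exists_representatives
  exact ⟨R, hfin, hcard, hR, fun P h1 h2 => huniq P ⟨h1, h2⟩⟩
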